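/- Let G be a bridgeless cubic graph, let F be a 1^+-factor of G, and let e be any edge of G. Then there exists a perfect matching M of G with e ∈ M such that the subgraph G \ (F ∪ M), obtained by deleting all edges of F and M, is bipartite. -/

import Mathlib

namespace DartGraph

open Finset

set_option linter.unusedSectionVars false
set_option linter.unusedDecidableInType false
set_option linter.unusedFintypeInType false

variable {V D : Type*} [DecidableEq V] [Fintype D] [DecidableEq D]

/-- The darts leaving the vertex set `S`; `tail` gives the initial vertex of a dart and `σ`
reverses darts. -/
def cut (tail : D → V) (σ : D → D) (S : Finset V) : Finset D :=
  {d | tail d ∈ S ∧ tail (σ d) ∉ S}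

/-- `(tail, σ)` restricts to a bridgeless cubic multigraph with vertex set `A`. -/
structure IsBridgelessCubic (tail : D → V) (σ : D → D) (A : Finset V) : Prop where
  deg : ∀ v, #{d | tail d = v} = 3
  invol : ∀ d, tail d ∈ A → σ (σ d) = d
  ne : ∀ d, tail d ∈ A → σ d ≠ d
  closed : ∀ d, tail d ∈ A → tail (σ d) ∈ A
  bridgeless : ∀ S ⊆ A, #(cut tail σ S) ≠ 1

/-- The darts in `M` form a perfect matching of the multigraph with vertex set `A`. -/
structure IsPerfMatching (tail : D → V) (σ : D → D) (A : Finset V) (M : Set D) : Prop where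
  symm : ∀ d, tail d ∈ A → (d ∈ M ↔ σ d ∈ M)
  unique : ∀ v ∈ A, ∃! d, tail d = v ∧ d ∈ M

/-- `c` properly colours the edges of `K` inside `A`. -/
def IsColoring (tail : D → V) (σ : D → D) (A : Finset V) (K : Set D) (c : V → Bool) : Prop :=
  ∀ d, tail d ∈ A → d ∈ K → c (tail d) ≠ c (tail (σ d))

/-- Deleting a suitable perfect matching through `e` from `H` leaves a bipartite graph. -/
def Quellable (tail : D → V) (σ : D → D) (A : Finset V) (H : Set D) (e : D) : Prop :=
  ∃ M c, IsPerfMatching tail σ A M ∧ e ∈ M ∧ IsColoring tail σ A (H \ M) c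

/-- `H` is the dart set of a subgraph whose complement covers every vertex of `A`. -/
structure IsCofactor (tail : D → V) (σ : D → D) (A : Finset V) (H : Set D) : Prop where
  symm : ∀ d, tail d ∈ A → (d ∈ H ↔ σ d ∈ H)
  missing : ∀ v ∈ A, ∃ d, tail d = v ∧ d ∉ H

variable {tail : D → V} {σ : D → D} {A S : Finset V} {H M : Set D} {e : D}

theorem mem_cut {d : D} : d ∈ cut tail σ S ↔ tail d ∈ S ∧ tail (σ d) ∉ S := by
  simp [cut]

theorem exists_darts (hG : IsBridgelessCubic tail σ A) (d₀ : D) :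
    ∃ d₁ d₂, tail d₁ = tail d₀ ∧ tail d₂ = tail d₀ ∧ d₀ ≠ d₁ ∧ d₀ ≠ d₂ ∧ d₁ ≠ d₂ ∧
      ∀ d, tail d = tail d₀ → d = d₀ ∨ d = d₁ ∨ d = d₂ := by
  have h := hG.deg (tail d₀)
  have h0 : d₀ ∈ ({d | tail d = tail d₀} : Finset D) := by simp
  rw [← Finset.card_erase_add_one h0, Nat.add_right_cancel_iff, card_eq_two] at h
  obtain ⟨x, y, hxy, h⟩ := h
  have hm : ∀ d, (d ≠ d₀ ∧ tail d = tail d₀) ↔ d = x ∨ d = y := fun d ↦ by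
    simpa using Finset.ext_iff.1 h d
  have hx := hm x
  have hy := hm y
  refine ⟨x, y, by grind, by grind, by grind, by grind, hxy, fun d hd ↦ ?_⟩
  have := hm d
  grind

theorem exists_third_dart (hG : IsBridgelessCubic tail σ A) {d₀ d₁ : D}
    (ht : tail d₁ = tail d₀) (hne : d₀ ≠ d₁) :
    ∃ d₂, tail d₂ = tail d₀ ∧ d₀ ≠ d₂ ∧ d₁ ≠ d₂ ∧
      ∀ d, tail d = tail d₀ → d = d₀ ∨ d = d₁ ∨ d = d₂ := by
  obtain ⟨x, y, h⟩ := exists_darts hG d₀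
  grind

theorem card_darts (hG : IsBridgelessCubic tail σ A) (S : Finset V) :
    #{d | tail d ∈ S} = 3 * #S := by
  rw [Finset.card_eq_sum_card_fiberwise (f := tail) (t := S) (by intro d; simp)]
  rw [Finset.sum_congr rfl (g := fun _ ↦ 3), sum_const, smul_eq_mul, mul_comm]
  intro v hv
  rw [← hG.deg v, filter_filter]
  congr 1
  grind

theorem card_cut_add_le (hG : IsBridgelessCubic tail σ A) (S : Finset V) (K : Finset D)
    (hK : ∀ d ∈ K, tail d ∈ S ∧ tail (σ d) ∈ S) : #(cut tail σ S) + #K ≤ 3 * #S := by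
  rw [← card_darts hG, ← card_union_of_disjoint]
  · apply card_le_card
    grind [mem_cut]
  · rw [disjoint_left]
    grind [mem_cut]

theorem even_card_inner (hG : IsBridgelessCubic tail σ A) (hS : S ⊆ A) (K : Finset D)
    (hK : ∀ d, tail d ∈ A → (d ∈ K ↔ σ d ∈ K)) :
    Even #{d ∈ K | tail d ∈ S ∧ tail (σ d) ∈ S} := by
  have : ∑ d ∈ K with tail d ∈ S ∧ tail (σ d) ∈ S, (1 : ZMod 2) = 0 := by
    refine sum_involution (fun d _ ↦ σ d) (fun _ _ ↦ by decide) ?_ ?_ ?_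
    · intro d hd _
      exact hG.ne d (hS (by grind))
    · intro d hd
      have := hG.invol d (hS (by grind))
      have := hK d (hS (by grind))
      grind
    · intro d hd
      exact hG.invol d (hS (by grind))
  rw [sum_const, nsmul_one] at this
  exact (ZMod.natCast_eq_zero_iff_even).1 this

theorem even_card_iff_cut (hG : IsBridgelessCubic tail σ A) (hS : S ⊆ A) (K : Finset D)
    (hK : ∀ d, tail d ∈ A → (d ∈ K ↔ σ d ∈ K)) :
    Even #{d ∈ K | tail d ∈ S} ↔ Even #{d ∈ K | d ∈ cut tail σ S} := by
  have h := even_card_inner hG hS K hK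
  have : #{d ∈ K | tail d ∈ S} =
      #{d ∈ K | tail d ∈ S ∧ tail (σ d) ∈ S} + #{d ∈ K | d ∈ cut tail σ S} := by
    rw [← card_union_of_disjoint]
    · congr 1
      ext d
      simp only [mem_filter, mem_union, mem_cut]
      tauto
    · rw [disjoint_left]
      grind [mem_cut]
  rw [this, Nat.even_add]
  tauto

theorem even_card_cut (hG : IsBridgelessCubic tail σ A) (hS : S ⊆ A) :
    Even #S ↔ Even #(cut tail σ S) := by
  have h := even_card_iff_cut hG hS univ (by simp)
  have h3 := card_darts hG S
  rw [h3] at h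
  have : (univ.filter fun d ↦ d ∈ cut tail σ S) = cut tail σ S := by simp
  rw [this] at h
  rw [← h, Nat.even_mul]
  simp [show ¬ Even 3 by decide]

theorem cut_self (hG : IsBridgelessCubic tail σ A) : cut tail σ A = ∅ := by
  ext d
  simpa [mem_cut] using hG.closed d

theorem even_card (hG : IsBridgelessCubic tail σ A) : Even #A := by
  rw [even_card_cut hG subset_rfl, cut_self hG]
  simp

theorem tail_ne (hG : IsBridgelessCubic tail σ A) {d : D} (hd : tail d ∈ A) :
    tail (σ d) ≠ tail d := by
  intro h
  have h1 := card_cut_add_le hG {tail d} {d, σ d} (by simp [h, hG.invol d hd])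
  rw [card_pair (hG.ne d hd).symm, card_singleton] at h1
  have h2 := even_card_cut hG (S := {tail d}) (by simpa)
  have h3 := hG.bridgeless {tail d} (by simpa)
  have : #(cut tail σ {tail d}) = 0 := by omega
  simp [this] at h2

theorem card_cut_sdiff (hi : ∀ d, tail d ∈ A → σ (σ d) = d)
    (hc : ∀ d, tail d ∈ A → tail (σ d) ∈ A) (hS : S ⊆ A) :
    #(cut tail σ (A \ S)) = #(cut tail σ S) := by
  refine card_nbij' σ σ ?_ ?_ ?_ ?_ <;> intro d hd <;>
  · have h1 := hc d
    have h2 := hi d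
    have h3 : tail d ∈ S → tail d ∈ A := fun h ↦ hS h
    simp only [mem_coe, mem_cut, mem_sdiff] at *
    grind

/-- Every edge cut separating two sets of at least two vertices has at least four edges. -/
def CyclicallyFourConnected (tail : D → V) (σ : D → D) (A : Finset V) : Prop :=
  ∀ S ⊆ A, 2 ≤ #S → 2 ≤ #(A \ S) → 4 ≤ #(cut tail σ S)

theorem eq_of_tail_eq (hG : IsBridgelessCubic tail σ A) (hA : CyclicallyFourConnected tail σ A)
    (h5 : 5 ≤ #A) {d d' : D} (hd : tail d ∈ A) (h1 : tail d = tail d')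
    (h2 : tail (σ d) = tail (σ d')) : d = d' := by
  by_contra hne
  have hl := tail_ne hG hd
  have hc := hG.closed d hd
  have hi := hG.invol d hd
  have hi' := hG.invol d' (h1 ▸ hd)
  have hs : ({tail d, tail (σ d)} : Finset V) ⊆ A := by grind
  have h2' : #({tail d, tail (σ d)} : Finset V) = 2 := card_pair hl.symm
  have := hA _ hs h2'.ge (by rw [card_sdiff_of_subset hs]; omega)
  have hK : #({d, d', σ d, σ d'} : Finset D) = 4 := by
    have : d ≠ σ d' := by grind
    have : d' ≠ σ d := by grind
    have : d ≠ σ d := by grind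
    have : d' ≠ σ d' := by grind
    have : σ d ≠ σ d' := by grind
    simp [*]
  have := card_cut_add_le hG {tail d, tail (σ d)} {d, d', σ d, σ d'} (by grind)
  omega

theorem no_triangle (hG : IsBridgelessCubic tail σ A) (hA : CyclicallyFourConnected tail σ A)
    (h5 : 5 ≤ #A) {d₁ d₂ d₃ : D} (hd : tail d₁ ∈ A) (h1 : tail (σ d₁) = tail d₂)
    (h2 : tail (σ d₂) = tail d₃) (h3 : tail (σ d₃) = tail d₁) : False := by
  have m2 : tail d₂ ∈ A := h1 ▸ hG.closed _ hd
  have m3 : tail d₃ ∈ A := h2 ▸ hG.closed _ m2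
  have l1 := tail_ne hG hd
  have l2 := tail_ne hG m2
  have l3 := tail_ne hG m3
  have i1 := hG.invol _ hd
  have i2 := hG.invol _ m2
  have i3 := hG.invol _ m3
  have hs : ({tail d₁, tail d₂, tail d₃} : Finset V) ⊆ A := by grind
  have hc : #({tail d₁, tail d₂, tail d₃} : Finset V) = 3 :=
    card_eq_three.2 ⟨_, _, _, by grind, by grind, by grind, rfl⟩
  have := hA _ hs (by omega) (by rw [card_sdiff_of_subset hs]; omega)
  have hK : #({d₁, d₂, d₃, σ d₁, σ d₂, σ d₃} : Finset D) = 6 := by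
    have : d₁ ≠ d₂ := by grind
    have : d₁ ≠ d₃ := by grind
    have : d₂ ≠ d₃ := by grind
    have : d₁ ≠ σ d₁ := by grind
    have : d₁ ≠ σ d₂ := by grind
    have : d₁ ≠ σ d₃ := by grind
    have : d₂ ≠ σ d₁ := by grind
    have : d₂ ≠ σ d₂ := by grind
    have : d₂ ≠ σ d₃ := by grind
    have : d₃ ≠ σ d₁ := by grind
    have : d₃ ≠ σ d₂ := by grind
    have : d₃ ≠ σ d₃ := by grind
    have : σ d₁ ≠ σ d₂ := by grind
    have : σ d₁ ≠ σ d₃ := by grind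
    have : σ d₂ ≠ σ d₃ := by grind
    simp [*]
  have := card_cut_add_le hG {tail d₁, tail d₂, tail d₃} {d₁, d₂, d₃, σ d₁, σ d₂, σ d₃}
    (by grind (splits := 30))
  omega

/-- The dart `η` together with the other darts `x₁`, `x₂` at its tail and `y₁`, `y₂` at its
head, such that the two end vertices of `η` can be suppressed. -/
structure IsSwitch (tail : D → V) (σ : D → D) (A : Finset V) (η x₁ x₂ y₁ y₂ : D) : Prop where
  mem : tail η ∈ A
  tail_x₁ : tail x₁ = tail η
  tail_x₂ : tail x₂ = tail η
  tail_y₁ : tail y₁ = tail (σ η)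
  tail_y₂ : tail y₂ = tail (σ η)
  ne_x₁ : η ≠ x₁
  ne_x₂ : η ≠ x₂
  x₁_ne_x₂ : x₁ ≠ x₂
  ne_y₁ : σ η ≠ y₁
  ne_y₂ : σ η ≠ y₂
  y₁_ne_y₂ : y₁ ≠ y₂
  eq_x : ∀ d, tail d = tail η → d = η ∨ d = x₁ ∨ d = x₂
  eq_y : ∀ d, tail d = tail (σ η) → d = σ η ∨ d = y₁ ∨ d = y₂
  head_x₁ : tail (σ x₁) ≠ tail (σ η)
  head_x₂ : tail (σ x₂) ≠ tail (σ η)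
  head_y₁ : tail (σ y₁) ≠ tail η
  head_y₂ : tail (σ y₂) ≠ tail η

/-- The reversal of darts after deleting two adjacent vertices and joining the other ends of
`x₁`, `y₁` and those of `x₂`, `y₂`. -/
def switch (σ : D → D) (x₁ x₂ y₁ y₂ d : D) : D :=
  if d = σ x₁ then σ y₁ else if d = σ y₁ then σ x₁ else
  if d = σ x₂ then σ y₂ else if d = σ y₂ then σ x₂ else σ d

/-- The facts about a switch used to compute with it. -/
structure SwitchFacts (tail : D → V) (σ : D → D) (A : Finset V) (η x₁ x₂ y₁ y₂ : D) :
    Prop where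
  mem_y : tail (σ η) ∈ A
  ne : tail (σ η) ≠ tail η
  invol : σ (σ η) = η
  invol_x₁ : σ (σ x₁) = x₁
  invol_x₂ : σ (σ x₂) = x₂
  invol_y₁ : σ (σ y₁) = y₁
  invol_y₂ : σ (σ y₂) = y₂
  head_x₁ : tail (σ x₁) ≠ tail η
  head_x₂ : tail (σ x₂) ≠ tail η
  head_y₁ : tail (σ y₁) ≠ tail (σ η)
  head_y₂ : tail (σ y₂) ≠ tail (σ η)
  mem_x₁ : tail (σ x₁) ∈ A
  mem_x₂ : tail (σ x₂) ∈ A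
  mem_y₁ : tail (σ y₁) ∈ A
  mem_y₂ : tail (σ y₂) ∈ A
  n12 : σ x₁ ≠ σ x₂
  n13 : σ x₁ ≠ σ y₁
  n14 : σ x₁ ≠ σ y₂
  n23 : σ x₂ ≠ σ y₁
  n24 : σ x₂ ≠ σ y₂
  n34 : σ y₁ ≠ σ y₂

variable {η x₁ x₂ y₁ y₂ : D}

theorem IsSwitch.facts (hG : IsBridgelessCubic tail σ A) (h : IsSwitch tail σ A η x₁ x₂ y₁ y₂) :
    SwitchFacts tail σ A η x₁ x₂ y₁ y₂ := by
  obtain ⟨hm, hx1, hx2, hy1, hy2, -, -, nx, -, -, ny, -, -, -, -, -, -⟩ := h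
  have hmy := hG.closed η hm
  have i0 := hG.invol η hm
  have i1 := hG.invol x₁ (hx1 ▸ hm)
  have i2 := hG.invol x₂ (hx2 ▸ hm)
  have i3 := hG.invol y₁ (hy1 ▸ hmy)
  have i4 := hG.invol y₂ (hy2 ▸ hmy)
  have hn := tail_ne hG hm
  have inj : ∀ d d' : D, σ (σ d) = d → σ (σ d') = d' → d ≠ d' → σ d ≠ σ d' := by
    intro d d' h1 h2 h3 h4
    exact h3 (by rw [← h1, ← h2, h4])
  exact ⟨hmy, hn, i0, i1, i2, i3, i4, hx1 ▸ tail_ne hG (hx1 ▸ hm), hx2 ▸ tail_ne hG (hx2 ▸ hm),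
    hy1 ▸ tail_ne hG (hy1 ▸ hmy), hy2 ▸ tail_ne hG (hy2 ▸ hmy),
    hG.closed x₁ (hx1 ▸ hm), hG.closed x₂ (hx2 ▸ hm), hG.closed y₁ (hy1 ▸ hmy),
    hG.closed y₂ (hy2 ▸ hmy), inj _ _ i1 i2 nx,
    inj _ _ i1 i3 (by rintro rfl; exact hn (hy1.symm.trans hx1)),
    inj _ _ i1 i4 (by rintro rfl; exact hn (hy2.symm.trans hx1)),
    inj _ _ i2 i3 (by rintro rfl; exact hn (hy1.symm.trans hx2)),
    inj _ _ i2 i4 (by rintro rfl; exact hn (hy2.symm.trans hx2)), inj _ _ i3 i4 ny⟩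

theorem switch_x₁ : switch σ x₁ x₂ y₁ y₂ (σ x₁) = σ y₁ := by simp [switch]

theorem SwitchFacts.switch_y₁ (f : SwitchFacts tail σ A η x₁ x₂ y₁ y₂) :
    switch σ x₁ x₂ y₁ y₂ (σ y₁) = σ x₁ := by
  simp [switch, f.n13.symm]

theorem SwitchFacts.switch_x₂ (f : SwitchFacts tail σ A η x₁ x₂ y₁ y₂) :
    switch σ x₁ x₂ y₁ y₂ (σ x₂) = σ y₂ := by
  simp [switch, f.n12.symm, f.n23]

theorem SwitchFacts.switch_y₂ (f : SwitchFacts tail σ A η x₁ x₂ y₁ y₂) :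
    switch σ x₁ x₂ y₁ y₂ (σ y₂) = σ x₂ := by
  simp [switch, f.n14.symm, f.n24.symm, f.n34.symm]

theorem switch_of_ne {d : D} (h1 : d ≠ σ x₁) (h2 : d ≠ σ x₂) (h3 : d ≠ σ y₁) (h4 : d ≠ σ y₂) :
    switch σ x₁ x₂ y₁ y₂ d = σ d := by
  simp [switch, *]

/-- A dart whose head survives is not affected by the switch. -/
theorem IsSwitch.switch_eq (hG : IsBridgelessCubic tail σ A)
    (h : IsSwitch tail σ A η x₁ x₂ y₁ y₂) {d : D} (hx : tail (σ d) ≠ tail η)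
    (hy : tail (σ d) ≠ tail (σ η)) : switch σ x₁ x₂ y₁ y₂ d = σ d := by
  have f := h.facts hG
  apply switch_of_ne <;> rintro rfl
  · exact hx (by rw [f.invol_x₁, h.tail_x₁])
  · exact hx (by rw [f.invol_x₂, h.tail_x₂])
  · exact hy (by rw [f.invol_y₁, h.tail_y₁])
  · exact hy (by rw [f.invol_y₂, h.tail_y₂])

/-- A surviving dart is either unaffected by a switch or one of four darts. -/
theorem IsSwitch.head_mem (hG : IsBridgelessCubic tail σ A)
    (h : IsSwitch tail σ A η x₁ x₂ y₁ y₂) {d : D} (hd : tail d ∈ A \ {tail η, tail (σ η)})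
    (h1 : d ≠ σ x₁) (h2 : d ≠ σ x₂) (h3 : d ≠ σ y₁) (h4 : d ≠ σ y₂) :
    tail (σ d) ∈ A \ {tail η, tail (σ η)} := by
  have f := h.facts hG
  simp only [mem_sdiff, mem_insert, mem_singleton, not_or] at hd ⊢
  have hi := hG.invol d hd.1
  refine ⟨hG.closed d hd.1, fun hx ↦ ?_, fun hy ↦ ?_⟩
  · rcases h.eq_x _ hx with hx | hx | hx
    · exact hd.2.2 (by rw [← hx, hi])
    · exact h1 (by rw [← hx, hi])
    · exact h2 (by rw [← hx, hi])
  · rcases h.eq_y _ hy with hx | hx | hx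
    · exact hd.2.1 (by rw [← f.invol, ← hx, hi])
    · exact h3 (by rw [← hx, hi])
    · exact h4 (by rw [← hx, hi])

theorem card_eq_sdiff_add (K : Finset D) {a b c d : D} (h12 : a ≠ b) (h13 : a ≠ c) (h14 : a ≠ d)
    (h23 : b ≠ c) (h24 : b ≠ d) (h34 : c ≠ d) :
    #K = #(K \ {a, b, c, d}) + ((if a ∈ K then 1 else 0) + ((if b ∈ K then 1 else 0) +
      ((if c ∈ K then 1 else 0) + (if d ∈ K then 1 else 0)))) := by
  rw [← card_sdiff_add_card_inter K {a, b, c, d}, inter_comm, ← filter_mem_eq_inter, card_filter,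
    sum_insert (by simp [*]), sum_insert (by simp [*]), sum_insert (by simp [*]), sum_singleton]

open Classical in
theorem IsSwitch.card_cuts (hG : IsBridgelessCubic tail σ A)
    (h : IsSwitch tail σ A η x₁ x₂ y₁ y₂) (hS : S ⊆ A \ {tail η, tail (σ η)}) :
    ∃ n, #(cut tail σ S) = n + ((if tail (σ x₁) ∈ S then 1 else 0) +
      ((if tail (σ x₂) ∈ S then 1 else 0) + ((if tail (σ y₁) ∈ S then 1 else 0) +
        (if tail (σ y₂) ∈ S then 1 else 0)))) ∧
      #(cut tail σ (S ∪ {tail η, tail (σ η)})) = n + ((if tail (σ x₁) ∉ S then 1 else 0) +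
      ((if tail (σ x₂) ∉ S then 1 else 0) + ((if tail (σ y₁) ∉ S then 1 else 0) +
        (if tail (σ y₂) ∉ S then 1 else 0)))) ∧
      #(cut tail (switch σ x₁ x₂ y₁ y₂) S) = n +
      ((if tail (σ x₁) ∈ S ∧ tail (σ y₁) ∉ S then 1 else 0) +
      ((if tail (σ x₂) ∈ S ∧ tail (σ y₂) ∉ S then 1 else 0) +
      ((if tail (σ y₁) ∈ S ∧ tail (σ x₁) ∉ S then 1 else 0) +
        (if tail (σ y₂) ∈ S ∧ tail (σ x₂) ∉ S then 1 else 0)))) := by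
  have f := h.facts hG
  have sx : tail η ∉ S := fun hc ↦ by simpa using hS hc
  have sy : tail (σ η) ∉ S := fun hc ↦ by simpa using hS hc
  refine ⟨#(cut tail σ S \ {σ x₁, σ x₂, σ y₁, σ y₂}), ?_, ?_, ?_⟩
  · rw [card_eq_sdiff_add _ f.n12 f.n13 f.n14 f.n23 f.n24 f.n34]
    simp [mem_cut, f.invol_x₁, f.invol_x₂, f.invol_y₁, f.invol_y₂, h.tail_x₁, h.tail_x₂,
      h.tail_y₁, h.tail_y₂, sx, sy]
  · rw [card_eq_sdiff_add _ h.x₁_ne_x₂ (c := y₁) (d := y₂)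
      (fun hc ↦ f.n13 (by rw [hc])) (fun hc ↦ f.n14 (by rw [hc])) (fun hc ↦ f.n23 (by rw [hc]))
      (fun hc ↦ f.n24 (by rw [hc])) h.y₁_ne_y₂]
    simp only [mem_cut, mem_union, mem_insert, mem_singleton, h.tail_x₁, h.tail_x₂,
      h.tail_y₁, h.tail_y₂, f.head_x₁, f.head_x₂, f.head_y₁, f.head_y₂, h.head_x₁, h.head_x₂,
      h.head_y₁, h.head_y₂, or_false, or_true, true_or, true_and, or_self]
    congr 2
    ext d
    simp only [mem_sdiff, mem_cut, mem_union, mem_insert, mem_singleton, not_or]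
    constructor
    · rintro ⟨⟨ht | ht | ht, h1, h2, h3⟩, h4, h5, h6, h7⟩
      · refine ⟨⟨ht, h1⟩, ?_, ?_, ?_, ?_⟩ <;> rintro rfl
        · exact h2 (by rw [f.invol_x₁, h.tail_x₁])
        · exact h2 (by rw [f.invol_x₂, h.tail_x₂])
        · exact h3 (by rw [f.invol_y₁, h.tail_y₁])
        · exact h3 (by rw [f.invol_y₂, h.tail_y₂])
      · have := h.eq_x d ht
        grind
      · have := h.eq_y d ht
        have := f.invol
        grind
    · rintro ⟨⟨ht, h1⟩, h2, h3, h4, h5⟩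
      have := h.head_mem hG (hS ht) h2 h3 h4 h5
      simp only [mem_sdiff, mem_insert, mem_singleton, not_or] at this
      refine ⟨⟨.inl ht, h1, this.2.1, this.2.2⟩, ?_, ?_, ?_, ?_⟩ <;> rintro rfl
      · exact sx (h.tail_x₁ ▸ ht)
      · exact sx (h.tail_x₂ ▸ ht)
      · exact sy (h.tail_y₁ ▸ ht)
      · exact sy (h.tail_y₂ ▸ ht)
  · rw [card_eq_sdiff_add _ f.n12 f.n13 f.n14 f.n23 f.n24 f.n34]
    simp only [mem_cut, switch_x₁, f.switch_x₂, f.switch_y₁, f.switch_y₂]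
    congr 2
    ext d
    simp only [mem_sdiff, mem_cut, mem_insert, mem_singleton, not_or]
    refine and_congr_left fun ⟨h1, h2, h3, h4⟩ ↦ ?_
    rw [switch_of_ne h1 h2 h3 h4]

/-- A cut of the switched graph gives a cut of the same size, unless it separates the two new
edges. -/
theorem IsSwitch.card_cut_cases (hG : IsBridgelessCubic tail σ A)
    (h : IsSwitch tail σ A η x₁ x₂ y₁ y₂) (hS : S ⊆ A \ {tail η, tail (σ η)}) :
    #(cut tail σ S) = #(cut tail (switch σ x₁ x₂ y₁ y₂) S) ∨
    #(cut tail σ (S ∪ {tail η, tail (σ η)})) = #(cut tail (switch σ x₁ x₂ y₁ y₂) S) ∨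
    (#(cut tail σ S) = #(cut tail (switch σ x₁ x₂ y₁ y₂) S) + 2 ∧
      #(cut tail σ (S ∪ {tail η, tail (σ η)})) = #(cut tail (switch σ x₁ x₂ y₁ y₂) S) + 2 ∧
      (tail (σ x₁) ∈ S ↔ tail (σ y₁) ∈ S) ∧ (tail (σ x₂) ∈ S ↔ tail (σ y₂) ∈ S) ∧
      (tail (σ x₁) ∈ S ↔ tail (σ x₂) ∉ S)) := by
  classical
  obtain ⟨n, h1, h2, h3⟩ := h.card_cuts hG hS
  rw [h1, h2, h3]
  by_cases p1 : tail (σ x₁) ∈ S <;> by_cases p2 : tail (σ x₂) ∈ S <;>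
    by_cases p3 : tail (σ y₁) ∈ S <;> by_cases p4 : tail (σ y₂) ∈ S <;> simp [*]

/-- Bridgelessness is the only nontrivial property of a switched graph. -/
theorem IsSwitch.isBridgelessCubic (hG : IsBridgelessCubic tail σ A)
    (h : IsSwitch tail σ A η x₁ x₂ y₁ y₂)
    (hb : ∀ S ⊆ A \ {tail η, tail (σ η)}, #(cut tail (switch σ x₁ x₂ y₁ y₂) S) = 1 →
      #(cut tail σ S) = 3 → #(cut tail σ (S ∪ {tail η, tail (σ η)})) = 3 →
      (tail (σ x₁) ∈ S ↔ tail (σ y₁) ∈ S) → (tail (σ x₂) ∈ S ↔ tail (σ y₂) ∈ S) →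
      (tail (σ x₁) ∈ S ↔ tail (σ x₂) ∉ S) → False) :
    IsBridgelessCubic tail (switch σ x₁ x₂ y₁ y₂) (A \ {tail η, tail (σ η)}) := by
  have f := h.facts hG
  refine ⟨hG.deg, fun d hd ↦ ?_, fun d hd ↦ ?_, fun d hd ↦ ?_, fun S hS h1 ↦ ?_⟩
  · by_cases h1 : d = σ x₁
    · rw [h1, switch_x₁, f.switch_y₁]
    by_cases h2 : d = σ x₂
    · rw [h2, f.switch_x₂, f.switch_y₂]
    by_cases h3 : d = σ y₁
    · rw [h3, f.switch_y₁, switch_x₁]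
    by_cases h4 : d = σ y₂
    · rw [h4, f.switch_y₂, f.switch_x₂]
    have hm := h.head_mem hG hd h1 h2 h3 h4
    simp only [mem_sdiff, mem_insert, mem_singleton, not_or] at hd hm
    have hi := hG.invol d hd.1
    rw [switch_of_ne h1 h2 h3 h4, h.switch_eq hG, hi] <;> rw [hi]
    exacts [hd.2.1, hd.2.2]
  · have := f.n13
    have := f.n24
    have := hG.ne d (by grind)
    grind [switch]
  · by_cases h1 : d = σ x₁
    · rw [h1, switch_x₁]
      simp [f.mem_y₁, f.head_y₁, h.head_y₁]
    by_cases h2 : d = σ x₂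
    · rw [h2, f.switch_x₂]
      simp [f.mem_y₂, f.head_y₂, h.head_y₂]
    by_cases h3 : d = σ y₁
    · rw [h3, f.switch_y₁]
      simp [f.mem_x₁, f.head_x₁, h.head_x₁]
    by_cases h4 : d = σ y₂
    · rw [h4, f.switch_y₂]
      simp [f.mem_x₂, f.head_x₂, h.head_x₂]
    rw [switch_of_ne h1 h2 h3 h4]
    exact h.head_mem hG hd h1 h2 h3 h4
  · have hb' := hb S hS h1
    have hS' := hS.trans sdiff_subset
    have := hG.bridgeless S hS'
    have := hG.bridgeless (S ∪ {tail η, tail (σ η)})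
      (union_subset hS' (by simp [insert_subset_iff, h.mem, f.mem_y]))
    have := h.card_cut_cases hG hS
    rw [h1] at this
    tauto

theorem IsSwitch.isBridgelessCubic_of_cyclicallyFourConnected (hG : IsBridgelessCubic tail σ A)
    (hA : CyclicallyFourConnected tail σ A) (h : IsSwitch tail σ A η x₁ x₂ y₁ y₂)
    (h1 : tail (σ x₁) ≠ tail (σ y₁)) (h2 : tail (σ x₂) ≠ tail (σ y₂)) :
    IsBridgelessCubic tail (switch σ x₁ x₂ y₁ y₂) (A \ {tail η, tail (σ η)}) := by
  have f := h.facts hG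
  refine h.isBridgelessCubic hG fun S hS _ hc _ p1 p2 p3 ↦ ?_
  have hS' := hS.trans sdiff_subset
  have two : ∀ {T : Finset V} {a b : V}, a ≠ b → a ∈ T → b ∈ T → 2 ≤ #T := fun hab ha hb ↦
    Finset.one_lt_card.2 ⟨_, ha, _, hb, hab⟩
  have hxy : 2 ≤ #(A \ S) := two f.ne
    (mem_sdiff.2 ⟨f.mem_y, fun hc ↦ by simpa using hS hc⟩)
    (mem_sdiff.2 ⟨h.mem, fun hc ↦ by simpa using hS hc⟩)
  have hS2 : 2 ≤ #S := by
    by_cases p : tail (σ x₁) ∈ S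
    · exact two h1 p (p1.1 p)
    · have p' : tail (σ x₂) ∈ S := by tauto
      exact two h2 p' (p2.1 p')
  have := hA S hS' hS2 hxy
  omega

/-- A perfect matching of the switched graph avoiding the new edge at `x₁` lifts. -/
theorem IsSwitch.lift (hG : IsBridgelessCubic tail σ A) (h : IsSwitch tail σ A η x₁ x₂ y₁ y₂)
    (hM : IsPerfMatching tail (switch σ x₁ x₂ y₁ y₂) (A \ {tail η, tail (σ η)}) M)
    (hx : σ x₁ ∉ M) :
    ∃ N, IsPerfMatching tail σ A N ∧
      (∀ d, tail d ∈ A \ {tail η, tail (σ η)} → (d ∈ N ↔ d ∈ M)) ∧ x₁ ∉ N ∧ y₁ ∉ N ∧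
      (η ∈ N ∧ x₂ ∉ N ∧ y₂ ∉ N ∨ η ∉ N ∧ x₂ ∈ N ∧ y₂ ∈ N) := by
  have f := h.facts hG
  have hs := hM.symm
  have ht : ∀ d, tail d ∈ A \ {tail η, tail (σ η)} ↔
      tail d ∈ A ∧ tail d ≠ tail η ∧ tail d ≠ tail (σ η) := by simp
  have hy : σ y₁ ∉ M := by
    rwa [← f.switch_y₁, ← hs] at hx
    simp [f.mem_y₁, f.head_y₁, h.head_y₁]
  have hxy : σ x₂ ∈ M ↔ σ y₂ ∈ M := by
    rw [hs (σ x₂) ((ht _).2 ⟨f.mem_x₂, f.head_x₂, h.head_x₂⟩), f.switch_x₂]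
  obtain ⟨hm, hx1, hx2, hy1, hy2, nx1, nx2, nx, ny1, ny2, ny, ex, ey, -, -, -, -⟩ := id h
  obtain ⟨-, hn, hi, -, -, -, -, -, -, -, -, -, -, -, -, -, -, -, -, -, -⟩ := id f
  have main : ∀ a b : D, tail a = tail η → tail b = tail (σ η) →
      (∀ d, tail d = tail η ∨ tail d = tail (σ η) → ((d = a ∨ d = b) ↔ (σ d = a ∨ σ d = b ∨
        tail (σ d) ∈ A \ {tail η, tail (σ η)} ∧ σ d ∈ M))) →
      IsPerfMatching tail σ A
        {d | d = a ∨ d = b ∨ tail d ∈ A \ {tail η, tail (σ η)} ∧ d ∈ M} := by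
    intro a b ha hb hab
    constructor
    · intro d hd
      simp only [Set.mem_ofPred_eq]
      by_cases h0 : tail d = tail η ∨ tail d = tail (σ η)
      · rw [← hab d h0]
        have : tail d ∉ A \ {tail η, tail (σ η)} := by rw [ht]; tauto
        simp [this]
      · have h0' : tail d ∈ A \ {tail η, tail (σ η)} := by rw [ht]; tauto
        by_cases h1 : tail (σ d) = tail η ∨ tail (σ d) = tail (σ η)
        · have := hab (σ d) h1
          rw [hG.invol d hd] at this
          have : tail (σ d) ∉ A \ {tail η, tail (σ η)} := by rw [ht]; tauto
          grind
        · have h1' : tail (σ d) ∈ A \ {tail η, tail (σ η)} := by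
            rw [ht]
            have := hG.closed d hd
            tauto
          have := hs d h0'
          rw [h.switch_eq hG (by tauto) (by tauto)] at this
          grind
    · intro v hv
      by_cases v1 : v = tail η
      · refine ⟨a, ⟨by rw [ha, v1], .inl rfl⟩, ?_⟩
        rintro d ⟨hd, rfl | rfl | hd'⟩ <;> grind
      by_cases v2 : v = tail (σ η)
      · refine ⟨b, ⟨by rw [hb, v2], .inr (.inl rfl)⟩, ?_⟩
        rintro d ⟨hd, rfl | rfl | hd'⟩ <;> grind
      have hv' : v ∈ A \ {tail η, tail (σ η)} := by simp [*]
      obtain ⟨d, ⟨hd, hdM⟩, hu⟩ := hM.unique v hv'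
      refine ⟨d, ⟨hd, .inr (.inr ⟨hd ▸ hv', hdM⟩)⟩, ?_⟩
      rintro d' ⟨hd', rfl | rfl | hd''⟩
      · exact absurd (hd'.symm.trans ha) v1
      · exact absurd (hd'.symm.trans hb) v2
      · exact hu d' ⟨hd', hd''.2⟩
  have out : ∀ d, tail d ≠ tail η → tail d ≠ tail (σ η) → d ≠ η ∧ d ≠ σ η ∧ d ≠ x₂ ∧ d ≠ y₂ := by
    intro d h1 h2
    refine ⟨?_, ?_, ?_, ?_⟩ <;> rintro rfl <;> simp [*] at h1 h2
  have sep : ∀ d d', tail d = tail η → tail d' = tail (σ η) → d ≠ d' ∧ d' ≠ d := by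
    intro d d' h1 h2
    constructor <;> rintro rfl <;> exact hn (h2.symm.trans h1)
  have o1 := out _ f.head_x₁ h.head_x₁
  have o2 := out _ f.head_x₂ h.head_x₂
  have o3 := out _ h.head_y₁ f.head_y₁
  have o4 := out _ h.head_y₂ f.head_y₂
  have m1 : tail (σ x₁) ∈ A \ {tail η, tail (σ η)} := (ht _).2 ⟨f.mem_x₁, f.head_x₁, h.head_x₁⟩
  have m2 : tail (σ x₂) ∈ A \ {tail η, tail (σ η)} := (ht _).2 ⟨f.mem_x₂, f.head_x₂, h.head_x₂⟩
  have m3 : tail (σ y₁) ∈ A \ {tail η, tail (σ η)} := (ht _).2 ⟨f.mem_y₁, h.head_y₁, f.head_y₁⟩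
  have m4 : tail (σ y₂) ∈ A \ {tail η, tail (σ η)} := (ht _).2 ⟨f.mem_y₂, h.head_y₂, f.head_y₂⟩
  have n1 : tail η ∉ A \ {tail η, tail (σ η)} := by simp
  have n2 : tail (σ η) ∉ A \ {tail η, tail (σ η)} := by simp
  have s1 := sep _ _ hx1 rfl
  have s2 := sep _ _ hx2 rfl
  have s3 := sep _ _ rfl hy1
  have s4 := sep _ _ rfl hy2
  have s5 := sep _ _ hx1 hy1
  have s6 := sep _ _ hx1 hy2
  have s7 := sep _ _ hx2 hy1
  have s8 := sep _ _ hx2 hy2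
  have s9 := sep _ _ rfl rfl
  have inside : ∀ d, d ∈ A \ {tail η, tail (σ η)} → d ≠ tail η ∧ d ≠ tail (σ η) := by simp
  have t1 := nx1.symm
  have t2 := nx2.symm
  have t3 := ny1.symm
  have t4 := ny2.symm
  have t5 := nx.symm
  have t6 := ny.symm
  clear ht hs out sep
  by_cases hx2M : σ x₂ ∈ M
  · have hy2M := hxy.1 hx2M
    clear hxy
    refine ⟨_, main x₂ y₂ hx2 hy2 ?_, fun d hd ↦ ?_, ?_, ?_, .inr ⟨?_, by simp, by simp⟩⟩
    · rintro d (hd | hd)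
      · rcases ex d hd with rfl | rfl | rfl <;> simp [-mem_sdiff, *]
      · rcases ey d hd with rfl | rfl | rfl <;> simp [-mem_sdiff, *]
    · have : d ≠ x₂ := by rintro rfl; exact (inside _ hd).1 hx2
      have : d ≠ y₂ := by rintro rfl; exact (inside _ hd).2 hy2
      simp [-mem_sdiff, *]
    all_goals simp [-mem_sdiff, *]
  · have hy2M := mt hxy.2 hx2M
    clear hxy
    refine ⟨_, main η (σ η) rfl rfl ?_, fun d hd ↦ ?_, ?_, ?_, .inl ⟨by simp, ?_, ?_⟩⟩
    · rintro d (hd | hd)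
      · rcases ex d hd with rfl | rfl | rfl <;> simp [-mem_sdiff, *]
      · rcases ey d hd with rfl | rfl | rfl <;> simp [-mem_sdiff, *]
    · have h1 : d ≠ η := by rintro rfl; exact (inside _ hd).1 rfl
      have h2 : d ≠ σ η := by rintro rfl; exact (inside _ hd).2 rfl
      simp [-mem_sdiff, h1, h2, hd]
    all_goals simp [-mem_sdiff, *]

theorem exists_inverse_of_card_eq {α : Type*} {s t : Finset α} (h : #s = #t) :
    ∃ f g : α → α, (∀ d ∈ s, f d ∈ t ∧ g (f d) = d) ∧ ∀ d ∈ t, g d ∈ s ∧ f (g d) = d := by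
  classical
  let φ := Finset.equivOfCardEq h
  refine ⟨fun d ↦ if h : d ∈ s then φ ⟨d, h⟩ else d, fun d ↦ if h : d ∈ t then φ.symm ⟨d, h⟩ else d,
    fun d hd ↦ ?_, fun d hd ↦ ?_⟩ <;> simp [hd]

/-- The side `S` of a cut with three edges becomes a bridgeless cubic graph if the other side is
contracted to a single vertex `b`. -/
theorem exists_contraction (hG : IsBridgelessCubic tail σ A) (hS : S ⊆ A)
    (h3 : #(cut tail σ S) = 3) {b : V} (hb : b ∉ S) :
    ∃ τ : D → D, IsBridgelessCubic tail τ (insert b S) ∧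
      (∀ d, tail d ∈ S → tail (σ d) ∈ S → τ d = σ d) ∧
      (∀ d ∈ cut tail σ S, tail (τ d) = b) ∧ ∀ d, tail d = b → τ d ∈ cut tail σ S := by
  obtain ⟨f, g, hf, hg⟩ := exists_inverse_of_card_eq (h3.trans (hG.deg b).symm)
  simp only [mem_filter, mem_univ, true_and] at hf hg
  let τ : D → D := fun d ↦ if tail d = b then g d else if d ∈ cut tail σ S then f d else σ d
  have τb : ∀ d, tail d = b → τ d = g d := fun d hd ↦ by simp [τ, hd]
  have ne_b : ∀ d, tail d ∈ S → tail d ≠ b := fun d hd h ↦ hb (h ▸ hd)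
  have τc : ∀ d ∈ cut tail σ S, τ d = f d := fun d hd ↦ by
    simp [τ, hd, ne_b d (mem_cut.1 hd).1]
  have τs : ∀ d, tail d ∈ S → tail (σ d) ∈ S → τ d = σ d := fun d hd hd' ↦ by
    simp [τ, ne_b d hd, mem_cut, hd']
  have cases : ∀ d, tail d ∈ insert b S →
      tail d = b ∨ d ∈ cut tail σ S ∨ tail d ∈ S ∧ tail (σ d) ∈ S := by
    intro d hd
    rw [mem_cut]
    grind
  have hi : ∀ d, tail d ∈ insert b S → τ (τ d) = d := by
    intro d hd
    rcases cases d hd with h | h | ⟨h, h'⟩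
    · rw [τb d h, τc _ (hg d h).1, (hg d h).2]
    · rw [τc d h, τb _ (hf d h).1, (hf d h).2]
    · rw [τs d h h', τs _ h'] <;> rw [hG.invol d (hS h)]
      exact h
  have hc : ∀ d, tail d ∈ insert b S → tail (τ d) ∈ insert b S := by
    intro d hd
    rcases cases d hd with h | h | ⟨h, h'⟩
    · rw [τb d h]
      exact mem_insert_of_mem (mem_cut.1 (hg d h).1).1
    · rw [τc d h, (hf d h).1]
      exact mem_insert_self _ _
    · rw [τs d h h']
      exact mem_insert_of_mem h'
  have hsub : ∀ T ⊆ S, #(cut tail τ T) ≠ 1 := by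
    intro T hT
    suffices cut tail τ T = cut tail σ T from this ▸ hG.bridgeless T (hT.trans hS)
    ext d
    simp only [mem_cut]
    refine and_congr_right fun hd ↦ ?_
    rcases cases d (mem_insert_of_mem (hT hd)) with h | h | ⟨h, h'⟩
    · exact absurd h (ne_b d (hT hd))
    · rw [τc d h, (hf d h).1]
      exact iff_of_true (fun hbT ↦ hb (hT hbT)) fun h' ↦ (mem_cut.1 h).2 (hT h')
    · rw [τs d h h']
  refine ⟨τ, ⟨hG.deg, hi, fun d hd ↦ ?_, hc, fun T hT ↦ ?_⟩, τs, fun d hd ↦ ?_, fun d hd ↦ ?_⟩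
  · rcases cases d hd with h | h | ⟨h, h'⟩
    · rw [τb d h]
      intro he
      exact ne_b _ (mem_cut.1 (hg d h).1).1 (by rw [he, h])
    · rw [τc d h]
      intro he
      exact ne_b d (mem_cut.1 h).1 (he ▸ (hf d h).1)
    · rw [τs d h h']
      exact hG.ne d (hS h)
  · by_cases hbT : b ∈ T
    · rw [← card_cut_sdiff hi hc hT]
      exact hsub _ (by grind)
    · exact hsub T (by grind)
  · rw [τc d hd, (hf d hd).1]
  · rw [τb d hd]
    exact (hg d hd).1

/-- The induction hypothesis for graphs with fewer vertices than `A`. -/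
def QuellableBelow (tail : D → V) (A : Finset V) : Prop :=
  ∀ (σ : D → D) (B : Finset V) (H : Set D) (e : D), #B < #A → IsBridgelessCubic tail σ B →
    IsCofactor tail σ B H → tail e ∈ B → Quellable tail σ B H e

theorem exists_side (IH : QuellableBelow tail A) (hG : IsBridgelessCubic tail σ A)
    (hH : IsCofactor tail σ A H) (hS : S ⊆ A) (h3 : #(cut tail σ S) = 3)
    (hcut : ∃ d ∈ cut tail σ S, d ∉ H) (h2 : 2 ≤ #(A \ S)) (he : tail e ∈ S) :
    ∃ (M : Set D) (c : V → Bool) (κ : Bool), ∃ f ∈ cut tail σ S, f ∈ M ∧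
      (∀ d ∈ cut tail σ S, d ∈ M → d = f) ∧
      (∀ v ∈ S, ∃! d, tail d = v ∧ d ∈ M) ∧
      (∀ d, tail d ∈ S → tail (σ d) ∈ S → (d ∈ M ↔ σ d ∈ M)) ∧
      (∀ d, tail d ∈ S → tail (σ d) ∈ S → d ∈ H \ M → c (tail d) ≠ c (tail (σ d))) ∧
      (∀ d ∈ cut tail σ S, d ∈ H \ M → c (tail d) ≠ κ) ∧ e ∈ M := by
  obtain ⟨b, hb⟩ : (A \ S).Nonempty := card_pos.1 (by omega)
  have hbS := (mem_sdiff.1 hb).2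
  obtain ⟨τ, hτ, hin, hcb, hbc⟩ := exists_contraction hG hS h3 hbS
  have hlt : #(insert b S) < #A := by
    rw [card_insert_of_notMem hbS]
    have := card_sdiff_of_subset hS
    omega
  have ne_b : ∀ d, tail d ∈ S → tail d ≠ b := fun d hd h ↦ hbS (h ▸ hd)
  have hi : ∀ d, tail d ∈ S → τ (τ d) = d := fun d hd ↦ hτ.invol d (mem_insert_of_mem hd)
  have hib : ∀ d, tail d = b → τ (τ d) = d := fun d hd ↦ hτ.invol d (hd ▸ mem_insert_self _ _)
  have cases : ∀ d, tail d ∈ insert b S →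
      tail d = b ∨ d ∈ cut tail σ S ∨ tail d ∈ S ∧ tail (σ d) ∈ S := by
    intro d hd
    rw [mem_cut]
    grind
  have hK : IsCofactor tail τ (insert b S) {d | tail d ∈ S ∧ d ∈ H ∨ tail d = b ∧ τ d ∈ H} := by
    constructor
    · intro d hd
      simp only [Set.mem_ofPred_eq]
      rcases cases d hd with h | h | ⟨h, h'⟩
      · have h1 := (mem_cut.1 (hbc d h)).1
        have := ne_b _ h1
        have : tail d ∉ S := h ▸ hbS
        simp [*]
      · have h1 := hcb d h
        have h2 := (mem_cut.1 h).1
        have := ne_b d h2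
        have := hi d h2
        simp [*]
      · have := hH.symm d (hS h)
        have := ne_b d h
        have := ne_b _ h'
        have := hin d h h'
        simp [*]
    · intro v hv
      rcases mem_insert.1 hv with rfl | hv
      · obtain ⟨d, hd, hdH⟩ := hcut
        refine ⟨τ d, hcb d hd, ?_⟩
        have := hi d (mem_cut.1 hd).1
        have := hcb d hd
        simp [*]
      · obtain ⟨d, rfl, hdH⟩ := hH.missing v (hS hv)
        have := ne_b d hv
        exact ⟨d, rfl, by simp [*]⟩
  obtain ⟨M, c, hM, heM, hc⟩ := IH τ _ _ e hlt hτ hK (mem_insert_of_mem he)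
  obtain ⟨g, ⟨hgb, hgM⟩, hgu⟩ := hM.unique b (mem_insert_self _ _)
  refine ⟨M, c, c b, τ g, hbc g hgb, ?_, fun d hd hdM ↦ ?_, fun v hv ↦ ?_, fun d hd hd' ↦ ?_,
    fun d hd hd' hdH ↦ ?_, fun d hd hdH ↦ ?_, heM⟩
  · rwa [← hM.symm g (hgb ▸ mem_insert_self _ _)]
  · rw [← hgu (τ d) ⟨hcb d hd, ?_⟩, hi d (mem_cut.1 hd).1]
    rwa [← hM.symm d (mem_insert_of_mem (mem_cut.1 hd).1)]
  · exact hM.unique v (mem_insert_of_mem hv)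
  · rw [← hin d hd hd']
    exact hM.symm d (mem_insert_of_mem hd)
  · rw [← hin d hd hd']
    exact hc d (mem_insert_of_mem hd) ⟨.inl ⟨hd, hdH.1⟩, hdH.2⟩
  · rw [← hcb d hd]
    exact hc d (mem_insert_of_mem (mem_cut.1 hd).1) ⟨.inl ⟨(mem_cut.1 hd).1, hdH.1⟩, hdH.2⟩

theorem quellable_of_three_cut_of_mem (IH : QuellableBelow tail A)
    (hG : IsBridgelessCubic tail σ A) (hH : IsCofactor tail σ A H) (hS : S ⊆ A)
    (h3 : #(cut tail σ S) = 3) (hcut : ∃ d ∈ cut tail σ S, d ∉ H) (h2 : 2 ≤ #S)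
    (h2' : 2 ≤ #(A \ S)) (he : tail e ∈ S) : Quellable tail σ A H e := by
  have hσ : ∀ d ∈ cut tail σ S, σ d ∈ cut tail σ (A \ S) := by
    intro d hd
    rw [mem_cut] at hd ⊢
    rw [hG.invol d (hS hd.1)]
    simp [hG.closed d (hS hd.1), hd]
  have hσ' : ∀ d, tail d ∈ A \ S → tail (σ d) ∈ S → σ d ∈ cut tail σ S := by
    intro d hd hd'
    rw [mem_sdiff] at hd
    rw [mem_cut, hG.invol d hd.1]
    exact ⟨hd', hd.2⟩
  obtain ⟨M₁, c₁, κ₁, f, hf, hfM, hfu, hu₁, hs₁, hc₁, hk₁, he₁⟩ :=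
    exists_side IH hG hH hS h3 hcut h2' he
  obtain ⟨M₂, c₂, κ₂, f', hf', hfM', hfu', hu₂, hs₂, hc₂, hk₂, he₂⟩ :=
    exists_side (S := A \ S) (e := σ f) IH hG hH sdiff_subset
      (by rw [card_cut_sdiff hG.invol hG.closed hS, h3])
      (by
        obtain ⟨d, hd, hdH⟩ := hcut
        exact ⟨σ d, hσ d hd, by rwa [← hH.symm d (hS (mem_cut.1 hd).1)]⟩)
      (by rwa [Finset.sdiff_sdiff_eq_self hS]) (mem_cut.1 (hσ f hf)).1
  obtain rfl := hfu' _ (hσ f hf) he₂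
  have hcM : ∀ d ∈ cut tail σ S, (d ∈ M₁ ↔ σ d ∈ M₂) := by
    intro d hd
    constructor
    · intro h
      rwa [hfu d hd h]
    · intro h
      have := hfu' _ (hσ d hd) h
      rwa [← hG.invol d (hS (mem_cut.1 hd).1), this, hG.invol f (hS (mem_cut.1 hf).1)]
  have hcol : ∀ d ∈ cut tail σ S, d ∈ H → d ∉ M₁ →
      c₁ (tail d) ≠ ((c₂ (tail (σ d))) ^^ !(κ₁ ^^ κ₂)) := by
    intro d hd hdH hdM
    have h1 := hk₁ d hd ⟨hdH, hdM⟩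
    have h2 := hk₂ (σ d) (hσ d hd)
      ⟨by rwa [← hH.symm d (hS (mem_cut.1 hd).1)], by rwa [← hcM d hd]⟩
    clear hk₁ hk₂
    revert h1 h2
    generalize c₁ (tail d) = x, c₂ (tail (σ d)) = y
    revert x y κ₁ κ₂
    decide
  refine ⟨{d | tail d ∈ S ∧ d ∈ M₁ ∨ tail d ∉ S ∧ d ∈ M₂},
    fun v ↦ if v ∈ S then c₁ v else (c₂ v ^^ !(κ₁ ^^ κ₂)), ⟨fun d hd ↦ ?_, fun v hv ↦ ?_⟩,
    .inl ⟨he, he₁⟩, fun d hd hdH ↦ ?_⟩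
  · simp only [Set.mem_ofPred_eq]
    by_cases h1 : tail d ∈ S <;> by_cases h2 : tail (σ d) ∈ S <;>
      simp only [h1, h2, true_and, false_and, or_false, false_or, not_true, not_false_eq_true]
    · exact hs₁ d h1 h2
    · exact hcM d (mem_cut.2 ⟨h1, h2⟩)
    · have := hcM (σ d) (hσ' d (mem_sdiff.2 ⟨hd, h1⟩) h2)
      rw [this, hG.invol d hd]
    · exact hs₂ d (mem_sdiff.2 ⟨hd, h1⟩) (mem_sdiff.2 ⟨hG.closed d hd, h2⟩)
  · by_cases h1 : v ∈ S
    · obtain ⟨d, hd, hdu⟩ := hu₁ v h1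
      refine ⟨d, ⟨hd.1, .inl ⟨hd.1 ▸ h1, hd.2⟩⟩, ?_⟩
      rintro d' ⟨rfl, h | h⟩
      · exact hdu d' ⟨rfl, h.2⟩
      · exact absurd h1 h.1
    · obtain ⟨d, hd, hdu⟩ := hu₂ v (mem_sdiff.2 ⟨hv, h1⟩)
      refine ⟨d, ⟨hd.1, .inr ⟨hd.1 ▸ h1, hd.2⟩⟩, ?_⟩
      rintro d' ⟨rfl, h | h⟩
      · exact absurd h.1 h1
      · exact hdu d' ⟨rfl, h.2⟩
  · obtain ⟨hdH, hdM⟩ := hdH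
    simp only [Set.mem_ofPred_eq, not_or, not_and] at hdM
    by_cases h1 : tail d ∈ S <;> by_cases h2 : tail (σ d) ∈ S <;>
      simp only [h1, h2, if_true, if_false]
    · exact hc₁ d h1 h2 ⟨hdH, hdM.1 h1⟩
    · exact hcol d (mem_cut.2 ⟨h1, h2⟩) hdH (hdM.1 h1)
    · have hm := hσ' d (mem_sdiff.2 ⟨hd, h1⟩) h2
      have := hcol (σ d) hm (by rwa [← hH.symm d hd]) (by
        rw [hcM _ hm, hG.invol d hd]
        exact hdM.2 h1)
      rw [hG.invol d hd] at this
      exact this.symm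
    · have := hc₂ d (mem_sdiff.2 ⟨hd, h1⟩) (mem_sdiff.2 ⟨hG.closed d hd, h2⟩) ⟨hdH, hdM.2 h1⟩
      simpa using this

theorem quellable_of_three_cut (IH : QuellableBelow tail A)
    (hG : IsBridgelessCubic tail σ A) (hH : IsCofactor tail σ A H) (hS : S ⊆ A)
    (h3 : #(cut tail σ S) = 3)
    (hcut : ∀ S ⊆ A, #(cut tail σ S) = 3 → ∃ d ∈ cut tail σ S, d ∉ H) (h2 : 2 ≤ #S)
    (h2' : 2 ≤ #(A \ S)) (he : tail e ∈ A) : Quellable tail σ A H e := by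
  by_cases heS : tail e ∈ S
  · exact quellable_of_three_cut_of_mem IH hG hH hS h3 (hcut S hS h3) h2 h2' heS
  · have h3' := (card_cut_sdiff hG.invol hG.closed hS).trans h3
    exact quellable_of_three_cut_of_mem IH hG hH sdiff_subset h3' (hcut _ sdiff_subset h3') h2'
      (by rwa [Finset.sdiff_sdiff_eq_self hS]) (mem_sdiff.2 ⟨he, heS⟩)

theorem exists_three_cut_of_card_lt (hG : IsBridgelessCubic tail σ A) (hS : S ⊆ A)
    (h2 : 2 ≤ #S) (h3 : 3 ≤ #(A \ S)) (hc : #(cut tail σ S) < 4) :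
    ∃ T ⊆ A, 2 ≤ #T ∧ 2 ≤ #(A \ T) ∧ #(cut tail σ T) = 3 := by
  have key : #(cut tail σ S) = 3 ∨ ∃ b ∈ A \ S, #(cut tail σ (insert b S)) ≤ 3 ∧
      Even #(cut tail σ S) := by
    have hsub : ∀ b, ∀ d ∈ cut tail σ (insert b S), tail (σ d) ≠ b ∧
        (d ∈ cut tail σ S ∨ tail d = b) := by
      intro b d
      rw [mem_cut, mem_cut]
      grind
    by_cases h0 : #(cut tail σ S) = 0
    · obtain ⟨b, hb⟩ : (A \ S).Nonempty := card_pos.1 (by omega)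
      refine .inr ⟨b, hb, ?_, by simp [h0]⟩
      rw [← hG.deg b]
      apply card_le_card
      intro d hd
      rw [card_eq_zero] at h0
      simpa [h0] using (hsub b d hd).2
    by_cases h1 : #(cut tail σ S) = 2
    · obtain ⟨d₀, hd₀⟩ : (cut tail σ S).Nonempty := card_pos.1 (by omega)
      have hm := mem_cut.1 hd₀
      refine .inr ⟨tail (σ d₀), mem_sdiff.2 ⟨hG.closed _ (hS hm.1), hm.2⟩, ?_, by simp [h1]⟩
      have : cut tail σ (insert (tail (σ d₀)) S) ⊆
          (cut tail σ S).erase d₀ ∪ ({d | tail d = tail (σ d₀)} : Finset D).erase (σ d₀) := by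
        intro d hd
        have h1 := hsub _ d hd
        have h2 := (mem_cut.1 hd).2
        have : d ≠ d₀ := by
          rintro rfl
          exact h1.1 rfl
        have : d ≠ σ d₀ := by
          rintro rfl
          rw [hG.invol _ (hS hm.1)] at h2
          exact h2 (mem_insert_of_mem hm.1)
        simp [*]
      refine (card_le_card this).trans ((card_union_le _ _).trans ?_)
      rw [card_erase_of_mem hd₀, card_erase_of_mem (by simp), h1, hG.deg]
    · have := hG.bridgeless S hS
      left
      omega
  obtain h | ⟨b, hb, hle, hev⟩ := key
  · exact ⟨S, hS, h2, by omega, h⟩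
  · rw [mem_sdiff] at hb
    have hbS : insert b S ⊆ A := insert_subset hb.1 hS
    have hcard := card_insert_of_notMem hb.2
    have h1 := card_sdiff_of_subset hS
    refine ⟨insert b S, hbS, by omega, by rw [card_sdiff_of_subset hbS]; omega, ?_⟩
    have h4 := even_card_cut hG hbS
    have h5 := even_card_cut hG hS
    rw [hcard, Nat.even_add_one] at h4
    have h6 : ¬ Even #(cut tail σ (insert b S)) := by tauto
    have := hG.bridgeless _ hbS
    rw [Nat.not_even_iff_odd] at h6
    obtain ⟨k, hk⟩ := h6
    omega

theorem exists_three_cut (hG : IsBridgelessCubic tail σ A) (h5 : 5 ≤ #A)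
    (hA : ¬ CyclicallyFourConnected tail σ A) :
    ∃ T ⊆ A, 2 ≤ #T ∧ 2 ≤ #(A \ T) ∧ #(cut tail σ T) = 3 := by
  simp only [CyclicallyFourConnected, not_forall, not_le] at hA
  obtain ⟨S, hS, h2, h2', hc⟩ := hA
  have := card_sdiff_of_subset hS
  by_cases h : 3 ≤ #(A \ S)
  · exact exists_three_cut_of_card_lt hG hS h2 h hc
  · refine exists_three_cut_of_card_lt (S := A \ S) hG sdiff_subset h2' ?_ ?_
    · rw [Finset.sdiff_sdiff_eq_self hS]
      omega
    · rwa [card_cut_sdiff hG.invol hG.closed hS]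

theorem isColoring_of_card_eq_four (hG : IsBridgelessCubic tail σ A) {u v p q : V}
    (hA : A = {u, v, p, q}) (h1 : ∀ d, tail d = u → tail (σ d) = v → d ∈ M)
    (h2 : ∀ d, tail d = v → tail (σ d) = u → d ∈ M)
    (h3 : ∀ d, tail d = p → tail (σ d) = q → d ∈ M)
    (h4 : ∀ d, tail d = q → tail (σ d) = p → d ∈ M)
    (hu : u ≠ p ∧ u ≠ q) (hv : v ≠ p ∧ v ≠ q) :
    IsColoring tail σ A (H \ M) fun x ↦ decide (x = u ∨ x = v) := by
  rintro d hd ⟨-, hdM⟩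
  have hne := tail_ne hG hd
  have hc := hG.closed d hd
  have g1 := h1 d
  have g2 := h2 d
  have g3 := h3 d
  have g4 := h4 d
  simp only [hA, mem_insert, mem_singleton] at hd hc
  rcases hd with hd | hd | hd | hd <;> rcases hc with hc | hc | hc | hc <;>
    rw [hd, hc, ne_eq, decide_eq_decide] <;> grind

theorem IsPerfMatching.not_star (hG : IsBridgelessCubic tail σ A)
    (hM : IsPerfMatching tail σ A M) {d₁ d₂ d₃ : D} (hd : tail d₁ ∈ A) (h2 : tail d₂ = tail d₁)
    (h3 : tail d₃ = tail d₁) (h12 : d₁ ≠ d₂) (h13 : d₁ ≠ d₃) (h23 : d₂ ≠ d₃) (m1 : d₁ ∉ M)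
    (m2 : d₂ ∉ M) : d₃ ∈ M := by
  obtain ⟨d, ⟨hd1, hdM⟩, -⟩ := hM.unique _ hd
  obtain ⟨x, -, -, -, hx⟩ := exists_third_dart hG h2 h12
  grind

theorem IsPerfMatching.exists_notMem (hG : IsBridgelessCubic tail σ A)
    (hM : IsPerfMatching tail σ A M) {v : V} (hv : v ∈ A) : ∃ d, tail d = v ∧ d ∉ M := by
  obtain ⟨d, ⟨rfl, hdM⟩, hu⟩ := hM.unique _ hv
  obtain ⟨x, -, hx, -, hdx, -⟩ := exists_darts hG d
  exact ⟨x, hx, fun hxM ↦ hdx (hu x ⟨hx, hxM⟩).symm⟩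

theorem exists_isColoring_of_card_eq_four (hG : IsBridgelessCubic tail σ A)
    (hM : IsPerfMatching tail σ A M) (h4 : #A = 4) : ∃ c, IsColoring tail σ A (H \ M) c := by
  obtain ⟨u, v, p, q, huv, hup, huq, hvp, hvq, hpq, hA⟩ := card_eq_four.1 h4
  let P : V → V → Prop := fun x y ↦ ∃ d, tail d = x ∧ tail (σ d) = y ∧ d ∉ M
  have symm : ∀ x ∈ A, ∀ y, P x y → P y x := by
    rintro x hx y ⟨d, rfl, rfl, hd⟩
    exact ⟨σ d, rfl, by rw [hG.invol d hx], by rwa [← hM.symm d hx]⟩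
  have star : ∀ x ∈ A, ∀ y z w, y ≠ z → y ≠ w → z ≠ w → ¬ (P x y ∧ P x z ∧ P x w) := by
    rintro x hx y z w hyz hyw hzw ⟨⟨d₁, rfl, rfl, m1⟩, ⟨d₂, h2, rfl, m2⟩, ⟨d₃, h3, rfl, m3⟩⟩
    exact m3 (hM.not_star hG hx h2 h3 (by rintro rfl; exact hyz rfl)
      (by rintro rfl; exact hyw rfl) (by rintro rfl; exact hzw rfl) m1 m2)
  have out : ∀ x ∈ A, ∃ y ∈ A, y ≠ x ∧ P x y := by
    intro x hx
    obtain ⟨d, rfl, hd⟩ := hM.exists_notMem hG hx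
    exact ⟨_, hG.closed d hx, tail_ne hG hx, d, rfl, rfl, hd⟩
  have notP : ∀ {x y}, ¬ P x y → ∀ d, tail d = x → tail (σ d) = y → d ∈ M := by
    intro x y h d h1 h2
    by_contra hd
    exact h ⟨d, h1, h2, hd⟩
  have hu : u ∈ A := by simp [hA]
  have hv : v ∈ A := by simp [hA]
  have hp : p ∈ A := by simp [hA]
  have hq : q ∈ A := by simp [hA]
  have : (¬ P u v ∧ ¬ P p q) ∨ (¬ P u p ∧ ¬ P v q) ∨ (¬ P u q ∧ ¬ P v p) := by
    have s1 := star u hu v p q hvp hvq hpq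
    have s2 := star v hv u p q hup huq hpq
    have s3 := star p hp u v q huv huq hvq
    have s4 := star q hq u v p huv hup hvp
    have o1 := out u hu
    have o2 := out v hv
    have o3 := out p hp
    have o4 := out q hq
    rw [hA] at o1 o2 o3 o4
    simp only [mem_insert, mem_singleton, exists_eq_or_imp, exists_eq_left, ne_eq, not_true,
      false_and, false_or, or_false] at o1 o2 o3 o4
    have e1 : P u v ↔ P v u := ⟨symm u hu v, symm v hv u⟩
    have e2 : P u p ↔ P p u := ⟨symm u hu p, symm p hp u⟩
    have e3 : P u q ↔ P q u := ⟨symm u hu q, symm q hq u⟩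
    have e4 : P v p ↔ P p v := ⟨symm v hv p, symm p hp v⟩
    have e5 : P v q ↔ P q v := ⟨symm v hv q, symm q hq v⟩
    have e6 : P p q ↔ P q p := ⟨symm p hp q, symm q hq p⟩
    clear_value P
    simp only [← e1, ← e2, ← e3, ← e4, ← e5, ← e6] at *
    clear e1 e2 e3 e4 e5 e6 symm star out notP
    grind
  obtain ⟨h1, h2⟩ | ⟨h1, h2⟩ | ⟨h1, h2⟩ := this
  · exact ⟨_, isColoring_of_card_eq_four hG hA (notP h1) (notP (mt (symm v hv u) h1)) (notP h2)
      (notP (mt (symm q hq p) h2)) ⟨hup, huq⟩ ⟨hvp, hvq⟩⟩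
  · exact ⟨_, isColoring_of_card_eq_four hG (u := u) (v := p) (p := v) (q := q)
      (by rw [hA]; ext; simp; tauto) (notP h1)
      (notP (mt (symm p hp u) h1)) (notP h2) (notP (mt (symm q hq v) h2)) ⟨huv, huq⟩
      ⟨hvp.symm, hpq⟩⟩
  · exact ⟨_, isColoring_of_card_eq_four hG (u := u) (v := q) (p := v) (q := p)
      (by rw [hA]; ext; simp; tauto) (notP h1)
      (notP (mt (symm q hq u) h1)) (notP h2) (notP (mt (symm p hp v) h2)) ⟨huv, hup⟩
      ⟨hvq.symm, hpq.symm⟩⟩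

theorem quellable_of_card_eq_two (hG : IsBridgelessCubic tail σ A) (h2 : #A = 2)
    (he : tail e ∈ A) : Quellable tail σ A H e := by
  have hA : A = {tail e, tail (σ e)} := by
    symm
    apply eq_of_subset_of_card_le
    · simp [insert_subset_iff, he, hG.closed e he]
    · rw [h2, card_pair (tail_ne hG he).symm]
  have hi := hG.invol e he
  have hl := tail_ne hG he
  refine ⟨{e, σ e}, fun x ↦ decide (x = tail e), ⟨fun d hd ↦ ?_, fun v hv ↦ ?_⟩, by simp,
    fun d hd _ ↦ ?_⟩
  · have := hG.invol d hd
    simp only [Set.mem_insert_iff, Set.mem_singleton_iff]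
    grind
  · simp only [hA, mem_insert, mem_singleton] at hv
    rcases hv with rfl | rfl
    · refine ⟨e, by simp, ?_⟩
      rintro d ⟨hd, rfl | rfl⟩
      exacts [rfl, absurd hd hl]
    · refine ⟨σ e, by simp, ?_⟩
      rintro d ⟨hd, rfl | rfl⟩
      exacts [absurd hd.symm hl, rfl]
  · have h1 := hG.closed d hd
    have h2 := tail_ne hG hd
    simp only [hA, mem_insert, mem_singleton] at hd h1
    simp only [ne_eq, decide_eq_decide]
    grind

theorem quellable_of_card_eq_four (hG : IsBridgelessCubic tail σ A) (h4 : #A = 4)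
    (he : tail e ∈ A) : Quellable tail σ A H e := by
  have hs : ({tail e, tail (σ e)} : Finset V) ⊆ A := by
    simp [insert_subset_iff, he, hG.closed e he]
  have hi := hG.invol e he
  have hl := tail_ne hG he
  have hc := card_sdiff_of_subset hs
  rw [card_pair hl.symm, h4] at hc
  obtain ⟨g, hg1, hg2⟩ : ∃ g, tail g ∈ A \ {tail e, tail (σ e)} ∧
      tail (σ g) ∈ A \ {tail e, tail (σ e)} := by
    by_contra! hcon
    have h1 := card_cut_add_le hG {tail e, tail (σ e)} {e, σ e} (by simp [hi])
    rw [card_pair hl.symm, card_pair (hG.ne e he).symm, ← card_cut_sdiff hG.invol hG.closed hs]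
      at h1
    have h2 := card_darts hG (A \ {tail e, tail (σ e)})
    rw [hc] at h2
    have h3 : #{d | tail d ∈ A \ {tail e, tail (σ e)}} ≤
        #(cut tail σ (A \ {tail e, tail (σ e)})) := by
      apply card_le_card
      intro d hd
      exact mem_cut.2 ⟨by simpa using hd, hcon d (by simpa using hd)⟩
    omega
  have hgA := (mem_sdiff.1 hg1).1
  have hig := hG.invol g hgA
  have hlg := tail_ne hG hgA
  have hgs : ({tail g, tail (σ g)} : Finset V) = A \ {tail e, tail (σ e)} := by
    apply eq_of_subset_of_card_le
    · exact insert_subset hg1 (singleton_subset_iff.2 hg2)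
    · rw [hc, card_pair hlg.symm]
  have hmem : ∀ v ∈ A, v = tail e ∨ v = tail (σ e) ∨ v = tail g ∨ v = tail (σ g) := by
    intro v hv
    have := Finset.ext_iff.1 hgs v
    simp only [mem_insert, mem_singleton, mem_sdiff] at this
    tauto
  simp only [mem_sdiff, mem_insert, mem_singleton, not_or] at hg1 hg2
  have hM : IsPerfMatching tail σ A {e, σ e, g, σ g} := by
    constructor
    · intro d hd
      have := hG.invol d hd
      simp only [Set.mem_insert_iff, Set.mem_singleton_iff]
      grind
    · intro v hv
      rcases hmem v hv with rfl | rfl | rfl | rfl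
      · refine ⟨e, by simp, ?_⟩
        rintro d ⟨hd, rfl | rfl | rfl | rfl⟩ <;> grind
      · refine ⟨σ e, by simp, ?_⟩
        rintro d ⟨hd, rfl | rfl | rfl | rfl⟩ <;> grind
      · refine ⟨g, by simp, ?_⟩
        rintro d ⟨hd, rfl | rfl | rfl | rfl⟩ <;> grind
      · refine ⟨σ g, by simp, ?_⟩
        rintro d ⟨hd, rfl | rfl | rfl | rfl⟩ <;> grind
  obtain ⟨c, hc⟩ := exists_isColoring_of_card_eq_four (H := H) hG hM h4
  exact ⟨_, c, hM, by simp, hc⟩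

/-- The darts of `H` whose heads survive the deletion of the end vertices of `η`. -/
def surviving (tail : D → V) (σ : D → D) (η : D) (H : Set D) : Set D :=
  {d | d ∈ H ∧ tail (σ d) ≠ tail η ∧ tail (σ d) ≠ tail (σ η)}

theorem mem_surviving {d : D} : d ∈ surviving tail σ η H ↔
    d ∈ H ∧ tail (σ d) ≠ tail η ∧ tail (σ d) ≠ tail (σ η) := Iff.rfl

theorem mem_sdiff_ends {d : D} : tail d ∈ A \ {tail η, tail (σ η)} ↔
    tail d ∈ A ∧ tail d ≠ tail η ∧ tail d ≠ tail (σ η) := by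
  simp

theorem IsSwitch.isCofactor (hG : IsBridgelessCubic tail σ A)
    (h : IsSwitch tail σ A η x₁ x₂ y₁ y₂)
    (hG' : IsBridgelessCubic tail (switch σ x₁ x₂ y₁ y₂) (A \ {tail η, tail (σ η)}))
    (hH : IsCofactor tail σ A H) :
    IsCofactor tail (switch σ x₁ x₂ y₁ y₂) (A \ {tail η, tail (σ η)})
      (surviving tail σ η H) := by
  have key : ∀ d, tail d ∈ A \ {tail η, tail (σ η)} → d ∈ surviving tail σ η H →
      switch σ x₁ x₂ y₁ y₂ d ∈ surviving tail σ η H := by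
    rintro d hd ⟨hdH, h1, h2⟩
    rw [mem_sdiff_ends] at hd
    rw [h.switch_eq hG h1 h2, mem_surviving, ← hH.symm d hd.1, hG.invol d hd.1]
    exact ⟨hdH, hd.2⟩
  refine ⟨fun d hd ↦ ⟨key d hd, fun hd' ↦ ?_⟩, fun v hv ↦ ?_⟩
  · rw [← hG'.invol d hd]
    exact key _ (hG'.closed d hd) hd'
  · obtain ⟨d, hd, hdH⟩ := hH.missing v (mem_sdiff.1 hv).1
    exact ⟨d, hd, fun h ↦ hdH h.1⟩

theorem IsSwitch.isColoring (hG : IsBridgelessCubic tail σ A)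
    (h : IsSwitch tail σ A η x₁ x₂ y₁ y₂) (hH : ∀ d, tail d ∈ A → (d ∈ H ↔ σ d ∈ H))
    {N : Set D} (hN : ∀ d, tail d ∈ A → (d ∈ N ↔ σ d ∈ N))
    (hNM : ∀ d, tail d ∈ A \ {tail η, tail (σ η)} → (d ∈ N ↔ d ∈ M)) {c : V → Bool}
    (hc : IsColoring tail (switch σ x₁ x₂ y₁ y₂) (A \ {tail η, tail (σ η)})
      (surviving tail σ η H \ M) c) (a b : Bool)
    (h0 : η ∈ H → η ∉ N → a ≠ b) (h1 : x₁ ∈ H → x₁ ∉ N → a ≠ c (tail (σ x₁)))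
    (h2 : x₂ ∈ H → x₂ ∉ N → a ≠ c (tail (σ x₂))) (h3 : y₁ ∈ H → y₁ ∉ N → b ≠ c (tail (σ y₁)))
    (h4 : y₂ ∈ H → y₂ ∉ N → b ≠ c (tail (σ y₂))) :
    IsColoring tail σ A (H \ N)
      fun v ↦ if v = tail η then a else if v = tail (σ η) then b else c v := by
  have f := h.facts hG
  set c' : V → Bool := fun v ↦ if v = tail η then a else if v = tail (σ η) then b else c v with hc'
  have ca : c' (tail η) = a := by simp [c']
  have cb : c' (tail (σ η)) = b := by simp [c', f.ne]
  have cc : ∀ v, v ≠ tail η → v ≠ tail (σ η) → c' v = c v := fun v h1 h2 ↦ by simp [c', h1, h2]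
  have key : ∀ d, tail d ∈ A → tail d = tail η ∨ tail d = tail (σ η) → d ∈ H → d ∉ N →
      c' (tail d) ≠ c' (tail (σ d)) := by
    rintro d hdA (hd | hd) hdH hdN
    · rcases h.eq_x d hd with rfl | rfl | rfl
      · rw [ca, cb]
        exact h0 hdH hdN
      · rw [hd, ca, cc _ f.head_x₁ h.head_x₁]
        exact h1 hdH hdN
      · rw [hd, ca, cc _ f.head_x₂ h.head_x₂]
        exact h2 hdH hdN
    · rcases h.eq_y d hd with rfl | rfl | rfl
      · rw [cb, f.invol, ca]
        rw [← hH η h.mem] at hdH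
        rw [← hN η h.mem] at hdN
        exact (h0 hdH hdN).symm
      · rw [hd, cb, cc _ h.head_y₁ f.head_y₁]
        exact h3 hdH hdN
      · rw [hd, cb, cc _ h.head_y₂ f.head_y₂]
        exact h4 hdH hdN
  rintro d hd ⟨hdH, hdN⟩
  by_cases hx : tail d = tail η ∨ tail d = tail (σ η)
  · exact key d hd hx hdH hdN
  by_cases hy : tail (σ d) = tail η ∨ tail (σ d) = tail (σ η)
  · have := key (σ d) (hG.closed d hd) hy (by rwa [← hH d hd]) (by rwa [← hN d hd])
    rw [hG.invol d hd] at this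
    exact this.symm
  · rw [not_or] at hx hy
    have hm := mem_sdiff_ends.2 ⟨hd, hx⟩
    have := hc d hm ⟨⟨hdH, hy⟩, by rwa [← hNM d hm]⟩
    rw [h.switch_eq hG hy.1 hy.2] at this
    rwa [cc _ hx.1 hx.2, cc _ hy.1 hy.2]

theorem isSwitch_of_ne (hG : IsBridgelessCubic tail σ A) (hA : CyclicallyFourConnected tail σ A)
    (h5 : 5 ≤ #A) (hm : tail η ∈ A) (hx₁ : tail x₁ = tail η) (hx₂ : tail x₂ = tail η)
    (hy₁ : tail y₁ = tail (σ η)) (hy₂ : tail y₂ = tail (σ η)) (nx₁ : η ≠ x₁) (nx₂ : η ≠ x₂)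
    (nx : x₁ ≠ x₂) (ny₁ : σ η ≠ y₁) (ny₂ : σ η ≠ y₂) (ny : y₁ ≠ y₂) :
    IsSwitch tail σ A η x₁ x₂ y₁ y₂ := by
  have hi := hG.invol η hm
  have hmy := hG.closed η hm
  refine ⟨hm, hx₁, hx₂, hy₁, hy₂, nx₁, nx₂, nx, ny₁, ny₂, ny, fun d hd ↦ ?_, fun d hd ↦ ?_,
    fun h ↦ ?_, fun h ↦ ?_, fun h ↦ ?_, fun h ↦ ?_⟩
  · obtain ⟨x, -, -, -, hx⟩ := exists_third_dart hG hx₁ nx₁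
    grind
  · obtain ⟨x, -, -, -, hx⟩ := exists_third_dart hG hy₁ ny₁
    grind
  · exact nx₁ (eq_of_tail_eq hG hA h5 hm hx₁.symm h.symm)
  · exact nx₂ (eq_of_tail_eq hG hA h5 hm hx₂.symm h.symm)
  · exact ny₁ (eq_of_tail_eq hG hA h5 hmy hy₁.symm (by rw [hi, h]))
  · exact ny₂ (eq_of_tail_eq hG hA h5 hmy hy₂.symm (by rw [hi, h]))

theorem IsSwitch.isBridgelessCubic_of_noTriangle (hG : IsBridgelessCubic tail σ A)
    (hA : CyclicallyFourConnected tail σ A) (h5 : 5 ≤ #A)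
    (h : IsSwitch tail σ A η x₁ x₂ y₁ y₂) :
    IsBridgelessCubic tail (switch σ x₁ x₂ y₁ y₂) (A \ {tail η, tail (σ η)}) := by
  have f := h.facts hG
  refine h.isBridgelessCubic_of_cyclicallyFourConnected hG hA (fun hc ↦ ?_) fun hc ↦ ?_
  · exact no_triangle hG hA h5 h.mem h.tail_y₁.symm hc.symm (by rw [f.invol_x₁, h.tail_x₁])
  · exact no_triangle hG hA h5 h.mem h.tail_y₂.symm hc.symm (by rw [f.invol_x₂, h.tail_x₂])

theorem IsSwitch.card_lt (h : IsSwitch tail σ A η x₁ x₂ y₁ y₂) : #(A \ {tail η, tail (σ η)}) < #A :=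
  card_lt_card ⟨sdiff_subset, fun hc ↦ by simpa using hc h.mem⟩

theorem IsPerfMatching.notMem (hM : IsPerfMatching tail σ A M) {d : D} (he : tail e ∈ A)
    (heM : e ∈ M) (hd : tail d = tail e) (hne : d ≠ e) : d ∉ M :=
  fun hdM ↦ hne ((hM.unique _ he).unique ⟨hd, hdM⟩ ⟨rfl, heM⟩)

/-- No vertex of `A` has exactly one dart in `H`. -/
def HasNoEnds (tail : D → V) (A : Finset V) (H : Set D) : Prop :=
  ∀ d ∈ H, tail d ∈ A → ∃ d' ∈ H, tail d' = tail d ∧ d ≠ d'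

theorem IsCofactor.third_notMem (hG : IsBridgelessCubic tail σ A) (hH : IsCofactor tail σ A H)
    {d₁ d₂ d₃ : D} (hd : tail d₁ ∈ A) (h2 : tail d₂ = tail d₁) (h12 : d₁ ≠ d₂) (m1 : d₁ ∈ H)
    (m2 : d₂ ∈ H) (h3 : tail d₃ = tail d₁) (h13 : d₁ ≠ d₃) (h23 : d₂ ≠ d₃) : d₃ ∉ H := by
  obtain ⟨d, hd1, hdH⟩ := hH.missing _ hd
  obtain ⟨x, -, -, -, hx⟩ := exists_third_dart hG h2 h12
  grind

/-- The reduction at an edge of `H` one of whose ends is adjacent to an end of `e`. -/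
theorem quellable_of_adj (IH : QuellableBelow tail A) (hG : IsBridgelessCubic tail σ A)
    (hA : CyclicallyFourConnected tail σ A) (h5 : 5 ≤ #A) (hH : IsCofactor tail σ A H)
    (hE : HasNoEnds tail A H) (he : tail e ∈ A) {α : D} (hα : tail α = tail e) (hαe : α ≠ e)
    (hV : ∃ d ∈ H, tail d = tail (σ α)) : Quellable tail σ A H e := by
  classical
  have hαA : tail α ∈ A := hα ▸ he
  have hpA := hG.closed α hαA
  have hiα := hG.invol α hαA
  obtain ⟨η, hηH, hη, hηα⟩ : ∃ η ∈ H, tail η = tail (σ α) ∧ η ≠ σ α := by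
    obtain ⟨d, hdH, hd⟩ := hV
    by_cases hda : d = σ α
    · obtain ⟨d', hd'H, hd', hne⟩ := hE d hdH (hd ▸ hpA)
      exact ⟨d', hd'H, hd'.trans hd, fun h ↦ hne (hda.trans h.symm)⟩
    · exact ⟨d, hdH, hd, hda⟩
  have hηA : tail η ∈ A := hη ▸ hpA
  have hqA := hG.closed η hηA
  obtain ⟨ω₁, hω₁, hηω₁, hαω₁, -⟩ := exists_third_dart hG hη.symm hηα
  have hσηH : σ η ∈ H := (hH.symm η hηA).1 hηH
  obtain ⟨θ, hθH, hθ, hηθ⟩ := hE (σ η) hσηH hqA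
  obtain ⟨ω₂, hω₂, hηω₂, hθω₂, -⟩ := exists_third_dart hG hθ hηθ
  have hω₂H : ω₂ ∉ H := hH.third_notMem hG hqA hθ hηθ hσηH hθH hω₂ hηω₂ hθω₂
  have hs : IsSwitch tail σ A η (σ α) ω₁ ω₂ θ :=
    isSwitch_of_ne hG hA h5 hηA hη.symm hω₁ hω₂ hθ hηα hηω₁ hαω₁ hηω₂ hηθ hθω₂.symm
  have f := hs.facts hG
  have hG' := hs.isBridgelessCubic_of_noTriangle hG hA h5
  have he' : tail e ∈ A \ {tail η, tail (σ η)} := by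
    rw [mem_sdiff_ends, ← hα, ← hiα]
    exact ⟨f.mem_x₁, f.head_x₁, hs.head_x₁⟩
  obtain ⟨M, c, hM, heM, hc⟩ := IH _ _ _ e (hs.card_lt) hG' (hs.isCofactor hG hG' hH) he'
  obtain ⟨N, hN, hNM, hN1, hN2, hN3⟩ := hs.lift hG hM
    (by rw [hiα]; exact hM.notMem he' heM hα hαe)
  have hNe := (hNM e he').2 heM
  have ext := fun a b ↦ hs.isColoring hG hH.symm hN.symm hNM hc a b
  rcases hN3 with ⟨hηN, h1, h2⟩ | ⟨hηN, h1, h2⟩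
  · refine ⟨N, _, hN, hNe, ext (if σ α ∈ H then !c (tail (σ (σ α))) else !c (tail (σ ω₁)))
      (!c (tail (σ θ))) (fun _ h ↦ absurd hηN h) (fun h _ ↦ by simp [h]) (fun h _ ↦ ?_)
      (fun h _ ↦ absurd h hω₂H) fun _ _ ↦ by simp⟩
    have : σ α ∉ H := hH.third_notMem hG hηA hω₁ hηω₁ hηH h hη.symm hηα hαω₁.symm
    simp [this]
  · exact ⟨N, _, hN, hNe, ext (!c (tail (σ (σ α)))) (c (tail (σ (σ α)))) (fun _ _ ↦ by simp)
      (fun _ _ ↦ by simp) (fun _ h ↦ absurd h1 h) (fun h _ ↦ absurd h hω₂H)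
      fun _ h ↦ absurd h2 h⟩

/-- The reduction at an edge that is not adjacent to an edge of `H`. -/
theorem quellable_of_far (IH : QuellableBelow tail A) (hG : IsBridgelessCubic tail σ A)
    (hA : CyclicallyFourConnected tail σ A) (h5 : 5 ≤ #A) (hH : IsCofactor tail σ A H)
    (he : tail e ∈ A) {α : D} (hα : tail α = tail e) (hαe : α ≠ e) (hη : tail η = tail (σ α))
    (hηα : η ≠ σ α) (hV : ∀ d ∈ H, tail d ≠ tail η) (hV' : ∀ d ∈ H, tail d ≠ tail (σ η)) :
    Quellable tail σ A H e := by
  have hαA : tail α ∈ A := hα ▸ he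
  have hiα := hG.invol α hαA
  have hηA : tail η ∈ A := hη ▸ hG.closed α hαA
  obtain ⟨x₂, hx₂, hηx₂, hαx₂, -⟩ := exists_third_dart hG hη.symm hηα
  obtain ⟨y₁, y₂, hy₁, hy₂, hηy₁, hηy₂, hy, -⟩ := exists_darts hG (σ η)
  have hs : IsSwitch tail σ A η (σ α) x₂ y₁ y₂ :=
    isSwitch_of_ne hG hA h5 hηA hη.symm hx₂ hy₁ hy₂ hηα hηx₂ hαx₂ hηy₁ hηy₂ hy
  have f := hs.facts hG
  have hG' := hs.isBridgelessCubic_of_noTriangle hG hA h5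
  have he' : tail e ∈ A \ {tail η, tail (σ η)} := by
    rw [mem_sdiff_ends, ← hα, ← hiα]
    exact ⟨f.mem_x₁, f.head_x₁, hs.head_x₁⟩
  obtain ⟨M, c, hM, heM, hc⟩ := IH _ _ _ e (hs.card_lt) hG' (hs.isCofactor hG hG' hH) he'
  obtain ⟨N, hN, hNM, -⟩ := hs.lift hG hM (by rw [hiα]; exact hM.notMem he' heM hα hαe)
  exact ⟨N, _, hN, (hNM e he').2 heM, hs.isColoring hG hH.symm hN.symm hNM hc true true
    (fun h _ ↦ absurd rfl (hV _ h)) (fun h _ ↦ absurd hη.symm (hV _ h))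
    (fun h _ ↦ absurd hx₂ (hV _ h)) (fun h _ ↦ absurd hy₁ (hV' _ h))
    fun h _ ↦ absurd hy₂ (hV' _ h)⟩

/-- A second switch next to a first one, pairing up the edge created by the first one. -/
theorem IsSwitch.isSwitch_isBridgelessCubic (hG : IsBridgelessCubic tail σ A)
    (hA : CyclicallyFourConnected tail σ A) (h5 : 5 ≤ #A) {α ζ x π₁ π₂ ω₁ ω₂ θ : D}
    (hs : IsSwitch tail σ A ζ (σ α) x π₁ π₂) (hα : tail α ∈ A) (hη : tail η = tail (σ π₁))
    (hω₁ : tail ω₁ = tail η) (hω₂ : tail ω₂ = tail (σ η)) (hθ : tail θ = tail (σ η))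
    (nη : η ≠ σ π₁) (nω₁ : η ≠ ω₁) (nω₁' : σ π₁ ≠ ω₁) (nω₂ : σ η ≠ ω₂) (nθ : σ η ≠ θ)
    (nω₂' : ω₂ ≠ θ) (ha : tail (σ η) ≠ tail ζ) (hu : tail (σ η) ≠ tail α)
    (hz : ∀ r, tail r = tail α → tail (σ r) ≠ tail (σ ζ))
    (hn : ∀ r, tail r = tail α → tail (σ r) ≠ tail (σ η)) :
    IsSwitch tail (switch σ (σ α) x π₁ π₂) (A \ {tail ζ, tail (σ ζ)}) η (σ π₁) ω₁ ω₂ θ ∧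
    IsBridgelessCubic tail (switch (switch σ (σ α) x π₁ π₂) (σ π₁) ω₁ ω₂ θ)
      ((A \ {tail ζ, tail (σ ζ)}) \ {tail η, tail (switch σ (σ α) x π₁ π₂ η)}) := by
  have f := hs.facts hG
  have hG' := hs.isBridgelessCubic_of_noTriangle hG hA h5
  have hiα := hG.invol α hα
  have hηA : tail η ∈ A := hη ▸ f.mem_y₁
  have hqA := hG.closed η hηA
  have multi : ∀ d, tail d = tail η → d ≠ σ π₁ → tail (σ d) ≠ tail (σ ζ) := fun d hd hne h ↦
    hne (eq_of_tail_eq hG hA h5 (hd ▸ hηA) (hd.trans hη) (by rw [h, f.invol_y₁, hs.tail_y₁]))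
  have hα' : tail α = tail (σ (σ α)) := by rw [hiα]
  have mη : tail η ∈ A \ {tail ζ, tail (σ ζ)} :=
    mem_sdiff_ends.2 ⟨hηA, hη ▸ hs.head_y₁, hη ▸ f.head_y₁⟩
  have mα : tail α ∈ A \ {tail ζ, tail (σ ζ)} :=
    mem_sdiff_ends.2 ⟨hα, hα' ▸ f.head_x₁, hα' ▸ hs.head_x₁⟩
  have mq : tail (σ η) ∈ A \ {tail ζ, tail (σ ζ)} := mem_sdiff_ends.2 ⟨hqA, ha, multi η rfl nη⟩
  have eη : switch σ (σ α) x π₁ π₂ η = σ η := hs.switch_eq hG ha (multi η rfl nη)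
  have eδ : switch σ (σ α) x π₁ π₂ (σ π₁) = α := f.switch_y₁.trans hiα
  have eω : switch σ (σ α) x π₁ π₂ ω₁ = σ ω₁ :=
    hs.switch_eq hG (fun h ↦ no_triangle hG hA h5 hs.mem hs.tail_y₁.symm
      (hη.symm.trans hω₁.symm) h) (multi ω₁ hω₁ nω₁'.symm)
  have hω₁q : tail (σ ω₁) ≠ tail (σ η) := fun h ↦
    nω₁ (eq_of_tail_eq hG hA h5 hηA hω₁.symm h.symm)
  have tri : ∀ d, tail d = tail η → d = η ∨ d = σ π₁ ∨ d = ω₁ := by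
    obtain ⟨d₂, -, -, -, h⟩ := exists_third_dart hG hη.symm nη
    grind
  have heads : ∀ d, tail d = tail (σ η) → σ η ≠ d →
      tail (switch σ (σ α) x π₁ π₂ d) ≠ tail η := by
    intro d hd hne h
    have hi := hG'.invol d (hd ▸ mq)
    rcases tri _ h with h | h | h <;> rw [h] at hi
    · exact hne (eη.symm.trans hi)
    · exact hu (by rw [← hd, ← hi, eδ])
    · exact hω₁q (by rw [← hd, ← hi, eω])
  have hs' : IsSwitch tail (switch σ (σ α) x π₁ π₂) (A \ {tail ζ, tail (σ ζ)})
      η (σ π₁) ω₁ ω₂ θ := by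
    refine ⟨mη, hη.symm, hω₁, hω₂.trans (by rw [eη]), hθ.trans (by rw [eη]), nη, nω₁, nω₁',
      by rwa [eη], by rwa [eη], nω₂', tri, fun d hd ↦ ?_, ?_, ?_, heads ω₂ hω₂ nω₂, heads θ hθ nθ⟩
    · rw [eη] at hd ⊢
      obtain ⟨d₂, -, -, -, h⟩ := exists_third_dart hG hω₂ nω₂
      grind
    · rw [eδ, eη]
      exact hu.symm
    · rwa [eω, eη]
  refine ⟨hs', hs'.isBridgelessCubic hG' fun S hS _ hc hc' i₁ _ _ ↦ ?_⟩
  rw [eδ] at i₁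
  have f' := hs'.facts hG'
  have mw := f'.mem_y₁
  have w1 := hs'.head_y₁
  have w2 := f'.head_y₁
  set w := tail (switch σ (σ α) x π₁ π₂ ω₂) with hw
  rw [eη] at hS hc' w2
  have hwu : tail α ≠ w := by
    intro h
    have hi := hG'.invol ω₂ (hω₂ ▸ mq)
    by_cases hr : switch σ (σ α) x π₁ π₂ ω₂ = α
    · have : switch σ (σ α) x π₁ π₂ α = σ π₁ := by
        simpa only [hiα] using switch_x₁ (σ := σ) (x₁ := σ α) (x₂ := x) (y₁ := π₁) (y₂ := π₂)
      rw [hr, this] at hi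
      exact tail_ne hG hηA (by rw [hη, hi, hω₂])
    · have e := hs.switch_eq hG (fun h' ↦ hr (eq_of_tail_eq hG hA h5 (hw ▸ h ▸ hα) h.symm
        (by rw [h', hs.tail_x₁]))) (hz _ h.symm)
      exact hn _ h.symm (by rw [← e, hi, hω₂])
  have fin : ∀ U ⊆ A, #(cut tail σ U) = 3 → (tail α ∈ U ↔ w ∈ U) →
      (tail η ∈ U ↔ tail (σ η) ∈ U) → (tail α ∈ U ↔ tail η ∉ U) → False := by
    intro U hU h3 j₁ j₂ j₃
    have two : ∀ {T : Finset V} {a b : V}, a ≠ b → a ∈ T → b ∈ T → 2 ≤ #T := fun hab ha hb ↦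
      Finset.one_lt_card.2 ⟨_, ha, _, hb, hab⟩
    have hqη := (tail_ne hG hηA).symm
    have hwA := (mem_sdiff.1 mw).1
    by_cases p : tail α ∈ U
    · have := hA U hU (two hwu p (j₁.1 p)) (two hqη (by grind) (by grind))
      omega
    · have := hA U hU (two hqη (by grind) (by grind)) (two hwu (by grind) (by grind))
      omega
  obtain ⟨T, hT, h3, k₁, k₂, k₃⟩ : ∃ T ⊆ A \ {tail ζ, tail (σ ζ)},
      #(cut tail (switch σ (σ α) x π₁ π₂) T) = 3 ∧ (tail α ∈ T ↔ w ∈ T) ∧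
      (tail η ∈ T ↔ tail (σ η) ∈ T) ∧ (tail α ∈ T ↔ tail η ∉ T) := by
    have s1 : tail η ∉ S := fun h ↦ by simpa using hS h
    have s2 : tail (σ η) ∉ S := fun h ↦ by simpa using hS h
    by_cases p : tail α ∈ S
    · exact ⟨S, hS.trans sdiff_subset, hc, i₁, by simp [s1, s2], by simp [s1, p]⟩
    · refine ⟨S ∪ {tail η, tail (σ η)}, ?_, hc', ?_, by simp, ?_⟩
      · refine union_subset (hS.trans sdiff_subset) ?_
        simp only [insert_subset_iff, singleton_subset_iff, mη, mq, true_and]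
      · have := hs'.head_x₁
        have := f'.head_x₁
        grind
      · have := hs'.head_x₁
        have := f'.head_x₁
        grind
  rw [mem_sdiff_ends] at mη mα mq
  rw [hw, mem_sdiff_ends, ← hw] at mw
  rcases hs.card_cut_cases hG hT with h | h | ⟨-, -, h, -⟩
  · exact fin T (hT.trans sdiff_subset) (h.trans h3) k₁ k₂ k₃
  · refine fin (T ∪ {tail ζ, tail (σ ζ)}) (union_subset (hT.trans sdiff_subset) ?_) (h.trans h3)
      ?_ ?_ ?_
    · simp [insert_subset_iff, hs.mem, f.mem_y]
    all_goals simpa [mα.2, mη.2, mq.2, mw.2]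
  · rw [hiα, ← hη] at h
    exact iff_not_self (h.symm.trans k₃)

/-- The reduction at an edge at distance two from an edge of `H`. -/
theorem quellable_of_dist_two (IH : QuellableBelow tail A) (hG : IsBridgelessCubic tail σ A)
    (hA : CyclicallyFourConnected tail σ A) (h5 : 5 ≤ #A) (hH : IsCofactor tail σ A H)
    (hE : HasNoEnds tail A H) (he : tail e ∈ A) {α ζ : D} (hα : tail α = tail e) (hαe : α ≠ e)
    (hζ : tail ζ = tail (σ α)) (hζα : ζ ≠ σ α) (hu : ∀ d ∈ H, tail d ≠ tail e)
    (hn : ∀ r, tail r = tail e → ∀ d ∈ H, tail d ≠ tail (σ r))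
    (hV : ∃ d ∈ H, tail d = tail (σ ζ)) : Quellable tail σ A H e := by
  classical
  have hαA : tail α ∈ A := hα ▸ he
  have hiα := hG.invol α hαA
  have hζA : tail ζ ∈ A := hζ ▸ hG.closed α hαA
  have hzA := hG.closed ζ hζA
  have ha : ∀ d, tail d = tail ζ → d ∉ H := fun d hd h ↦ hn α hα d h (hd.trans hζ)
  obtain ⟨π₁, hπ₁H, hπ₁⟩ := hV
  obtain ⟨π₂, hπ₂H, hπ₂, hππ⟩ := hE π₁ hπ₁H (hπ₁ ▸ hzA)
  rw [hπ₁] at hπ₂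
  have hζH : σ ζ ∉ H := by
    rw [← hH.symm ζ hζA]
    exact ha ζ rfl
  obtain ⟨x, hx, hζx, hαx, -⟩ := exists_third_dart hG hζ.symm hζα
  have hs : IsSwitch tail σ A ζ (σ α) x π₁ π₂ :=
    isSwitch_of_ne hG hA h5 hζA hζ.symm hx hπ₁ hπ₂ hζα hζx hαx (fun h ↦ hζH (h ▸ hπ₁H))
      (fun h ↦ hζH (h ▸ hπ₂H)) hππ
  have f := hs.facts hG
  have hδH : σ π₁ ∈ H := (hH.symm π₁ (hπ₁ ▸ hzA)).1 hπ₁H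
  obtain ⟨η, hηH, hη, hδη⟩ := hE _ hδH f.mem_y₁
  have hηA : tail η ∈ A := hη ▸ f.mem_y₁
  have hqA := hG.closed η hηA
  have hσηH : σ η ∈ H := (hH.symm η hηA).1 hηH
  obtain ⟨ω₁, hω₁, hηω₁, hδω₁, -⟩ := exists_third_dart hG hη.symm hδη.symm
  have hω₁H : ω₁ ∉ H := hH.third_notMem hG hηA hη.symm hδη.symm hηH hδH hω₁ hηω₁ hδω₁
  obtain ⟨θ, hθH, hθ, hηθ⟩ := hE (σ η) hσηH hqA
  obtain ⟨ω₂, hω₂, hηω₂, hθω₂, -⟩ := exists_third_dart hG hθ hηθ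
  have hω₂H : ω₂ ∉ H := hH.third_notMem hG hqA hθ hηθ hσηH hθH hω₂ hηω₂ hθω₂
  obtain ⟨hs', hG''⟩ := hs.isSwitch_isBridgelessCubic hG hA h5 hαA hη hω₁ hω₂ hθ hδη.symm hηω₁
    hδω₁ hηω₂ hηθ hθω₂.symm (fun h ↦ ha _ h hσηH) (fun h ↦ hu _ hσηH (h.trans hα))
    (fun r hr h ↦ hn r (hr.trans hα) π₁ hπ₁H (hπ₁.trans h.symm))
    (fun r hr h ↦ hn r (hr.trans hα) _ hσηH h.symm)
  have hG' := hs.isBridgelessCubic_of_noTriangle hG hA h5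
  have f' := hs'.facts hG'
  have hH' := hs.isCofactor hG hG' hH
  have eδ : switch σ (σ α) x π₁ π₂ (σ π₁) = α := f.switch_y₁.trans hiα
  have he' : tail e ∈ A \ {tail ζ, tail (σ ζ)} := by
    rw [mem_sdiff_ends, ← hα, ← hiα]
    exact ⟨f.mem_x₁, f.head_x₁, hs.head_x₁⟩
  have he'' : tail e ∈ (A \ {tail ζ, tail (σ ζ)}) \
      {tail η, tail (switch σ (σ α) x π₁ π₂ η)} := by
    rw [mem_sdiff_ends]
    exact ⟨he', by simpa only [eδ, hα] using f'.head_x₁, by simpa only [eδ, hα] using hs'.head_x₁⟩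
  have eη : switch σ (σ α) x π₁ π₂ η = σ η := hs.switch_eq hG (fun h ↦ ha _ h hσηH) fun h ↦
    hδη.symm (eq_of_tail_eq hG hA h5 hηA hη (by rw [h, f.invol_y₁, hπ₁]))
  obtain ⟨M, c, hM, heM, hc⟩ := IH _ _ _ e (hs'.card_lt.trans hs.card_lt) hG''
    (hs'.isCofactor hG' hG'' hH') he''
  obtain ⟨N', hN', hNM', -, -, hN3⟩ := hs'.lift hG' hM
    (by rw [eδ]; exact hM.notMem he'' heM hα hαe)
  have hc' := hs'.isColoring hG' hH'.symm hN'.symm hNM' hc (c (tail (σ π₂)))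
    (if η ∈ N' then !c (tail (switch σ (σ α) x π₁ π₂ θ)) else !c (tail (σ π₂)))
    (fun _ h ↦ by simp [h]) (fun h _ ↦ absurd (by rw [f.invol_y₁, hπ₁]) h.2.2)
    (fun h _ ↦ absurd h.1 hω₁H) (fun h _ ↦ absurd h.1 hω₂H) (fun _ h ↦ by
      have : η ∈ N' := by tauto
      simp [this])
  have heN' := (hNM' e he'').2 heM
  obtain ⟨N, hN, hNM, -⟩ := hs.lift hG hN' (by rw [hiα]; exact hN'.notMem he' heN' hα hαe)
  refine ⟨N, _, hN, (hNM e he').2 heN', hs.isColoring hG hH.symm hN.symm hNM hc' true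
    (!c (tail (σ π₂))) (fun h ↦ absurd h (ha _ rfl)) (fun h ↦ absurd h (ha _ hs.tail_x₁))
    (fun h ↦ absurd h (ha _ hx)) (fun _ _ ↦ by simp [hη]) fun _ _ ↦ ?_⟩
  have n1 : tail (σ π₂) ≠ tail η := fun h ↦
    hππ (eq_of_tail_eq hG hA h5 (hπ₁ ▸ hzA) (hπ₁.trans hπ₂.symm) (h.trans hη).symm)
  have n2 : tail (σ π₂) ≠ tail (σ η) := fun h ↦
    no_triangle (d₃ := σ π₁) hG hA h5 (hπ₂ ▸ hzA) h (by rw [hG.invol η hηA, hη])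
      (by rw [f.invol_y₁, hπ₁, hπ₂])
  simp [n1, n2, eη]

theorem Quellable.of_symm (he : tail e ∈ A) (h : Quellable tail σ A H (σ e)) :
    Quellable tail σ A H e := by
  obtain ⟨M, c, hM, heM, hc⟩ := h
  exact ⟨M, c, hM, (hM.symm e he).2 heM, hc⟩

theorem quellable_of_cyclicallyFourConnected (IH : QuellableBelow tail A)
    (hG : IsBridgelessCubic tail σ A) (hA : CyclicallyFourConnected tail σ A) (h5 : 5 ≤ #A)
    (hH : IsCofactor tail σ A H) (hE : HasNoEnds tail A H) (he : tail e ∈ A) (heH : e ∉ H) :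
    Quellable tail σ A H e := by
  have he' := hG.closed e he
  have heH' : σ e ∉ H := by rwa [← hH.symm e he]
  by_cases hB : ∃ α, tail α = tail e ∧ α ≠ e ∧ ∃ d ∈ H, tail d = tail (σ α)
  · obtain ⟨α, hα, hαe, hV⟩ := hB
    exact quellable_of_adj IH hG hA h5 hH hE he hα hαe hV
  by_cases hB' : ∃ α, tail α = tail (σ e) ∧ α ≠ σ e ∧ ∃ d ∈ H, tail d = tail (σ α)
  · obtain ⟨α, hα, hαe, hV⟩ := hB'
    exact (quellable_of_adj IH hG hA h5 hH hE he' hα hαe hV).of_symm he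
  have hu : ∀ d ∈ H, tail d ≠ tail e := fun d hd h ↦
    hB ⟨d, h, fun h' ↦ heH (h' ▸ hd), σ d, (hH.symm d (h ▸ he)).1 hd, rfl⟩
  have hn : ∀ r, tail r = tail e → ∀ d ∈ H, tail d ≠ tail (σ r) := by
    intro r hr d hd h
    by_cases hre : r = e
    · rw [hre] at h
      exact hB' ⟨d, h, fun h' ↦ heH' (h' ▸ hd), σ d, (hH.symm d (h ▸ he')).1 hd, rfl⟩
    · exact hB ⟨r, hr, hre, d, hd, h⟩
  obtain ⟨α, -, hα, -, hαe, -⟩ := exists_darts hG e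
  obtain ⟨ζ, -, hζ, -, hζα, -⟩ := exists_darts hG (σ α)
  by_cases hV : ∃ d ∈ H, tail d = tail (σ ζ)
  · exact quellable_of_dist_two IH hG hA h5 hH hE he hα hαe.symm hζ hζα.symm hu hn hV
  · exact quellable_of_far IH hG hA h5 hH he hα hαe.symm hζ hζα.symm
      (fun d hd h ↦ hn α hα d hd (h.trans hζ)) fun d hd h ↦ hV ⟨d, hd, h⟩

open Classical in
theorem HasNoEnds.even_card (hG : IsBridgelessCubic tail σ A) (hH : IsCofactor tail σ A H)
    (hE : HasNoEnds tail A H) (hS : S ⊆ A) : Even #{d ∈ cut tail σ S | d ∈ H} := by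
  have h := even_card_iff_cut hG hS ({d | d ∈ H} : Finset D) (by simpa using hH.symm)
  have hf : filter (· ∈ cut tail σ S) {d | d ∈ H} = filter (· ∈ H) (cut tail σ S) := by
    ext
    simp [and_comm]
  rw [← hf, ← h, card_eq_sum_card_fiberwise (f := tail) (t := S) (by intro d; simp)]
  refine even_sum _ fun v hv ↦ ?_
  by_cases hd : ∃ d ∈ H, tail d = v
  · obtain ⟨d, hdH, rfl⟩ := hd
    obtain ⟨d', hd'H, hd', hne⟩ := hE d hdH (hS hv)
    have : filter (fun r ↦ tail r = tail d) (filter (fun r ↦ tail r ∈ S) {r | r ∈ H}) =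
        {d, d'} := by
      ext r
      have := fun hr h1 h2 ↦ hH.third_notMem (d₃ := r) hG (hS hv) hd' hne hdH hd'H hr h1 h2
      simp only [mem_filter, mem_univ, true_and, mem_insert, mem_singleton]
      grind
    rw [this, card_pair hne]
    exact even_two
  · rw [filter_false_of_mem, card_empty]
    · exact Even.zero
    · intro d hdm hdv
      exact hd ⟨d, by simpa using (mem_filter.1 hdm).1, hdv⟩

theorem HasNoEnds.exists_notMem (hG : IsBridgelessCubic tail σ A) (hH : IsCofactor tail σ A H)
    (hE : HasNoEnds tail A H) (hS : S ⊆ A) (h3 : #(cut tail σ S) = 3) :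
    ∃ d ∈ cut tail σ S, d ∉ H := by
  classical
  by_contra! h
  have he := hE.even_card hG hH hS
  rw [filter_true_of_mem h, h3] at he
  exact absurd he (by decide)

theorem IsCofactor.sdiff (hG : IsBridgelessCubic tail σ A) (hH : IsCofactor tail σ A H) {d : D}
    (hd : tail d ∈ A) : IsCofactor tail σ A (H \ {d, σ d}) := by
  refine ⟨fun r hr ↦ ?_, fun v hv ↦ ?_⟩
  · have h1 := hG.invol r hr
    have h2 := hG.invol d hd
    have h3 := hH.symm r hr
    simp only [Set.mem_sdiff, Set.mem_insert_iff, Set.mem_singleton_iff]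
    grind
  · obtain ⟨r, hr, hrH⟩ := hH.missing v hv
    exact ⟨r, hr, fun h ↦ hrH h.1⟩

theorem Quellable.of_sdiff_self (he : tail e ∈ A)
    (h : Quellable tail σ A (H \ {e, σ e}) e) : Quellable tail σ A H e := by
  obtain ⟨M, c, hM, heM, hc⟩ := h
  refine ⟨M, c, hM, heM, fun d hd hdH ↦ hc d hd ⟨⟨hdH.1, ?_⟩, hdH.2⟩⟩
  rintro (rfl | rfl)
  · exact hdH.2 heM
  · exact hdH.2 ((hM.symm e he).1 heM)

theorem Quellable.of_sdiff_end (hG : IsBridgelessCubic tail σ A) (hH : IsCofactor tail σ A H)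
    {d : D} (hd : tail d ∈ A) (hend : ∀ d' ∈ H, tail d' = tail d → d = d')
    (h : Quellable tail σ A (H \ {d, σ d}) e) : Quellable tail σ A H e := by
  obtain ⟨M, c, hM, heM, hc⟩ := h
  have hn := tail_ne hG hd
  refine ⟨M, Function.update c (tail d) (!c (tail (σ d))), hM, heM, fun r hr hrH ↦ ?_⟩
  by_cases h1 : r = d
  · subst h1
    simp [hn]
  by_cases h2 : r = σ d
  · subst h2
    simp [hn, hG.invol d hd]
  · have n1 : tail r ≠ tail d := fun h ↦ h1 (hend r hrH.1 h).symm
    have n2 : tail (σ r) ≠ tail d := fun h ↦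
      h2 (by rw [hend _ ((hH.symm r hr).1 hrH.1) h, hG.invol r hr])
    rw [Function.update_of_ne n1, Function.update_of_ne n2]
    exact hc r hr ⟨⟨hrH.1, by simp [h1, h2]⟩, hrH.2⟩

theorem quellable_of_quellableBelow (IH : QuellableBelow tail A) (hG : IsBridgelessCubic tail σ A)
    (hH : IsCofactor tail σ A H) (he : tail e ∈ A) : Quellable tail σ A H e := by
  induction hn : H.ncard using Nat.strong_induction_on generalizing H with
  | _ n ih =>
  have step : ∀ d ∈ H, tail d ∈ A → Quellable tail σ A (H \ {d, σ d}) e := fun d hd hdA ↦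
    ih _ (hn ▸ Set.ncard_lt_ncard ⟨Set.sdiff_subset, fun h ↦ by simpa using h hd⟩)
      (hH.sdiff hG hdA) rfl
  by_cases heH : e ∈ H
  · exact (step e heH he).of_sdiff_self he
  by_cases hE : HasNoEnds tail A H
  · by_cases h2 : #A = 2
    · exact quellable_of_card_eq_two hG h2 he
    by_cases h4 : #A = 4
    · exact quellable_of_card_eq_four hG h4 he
    have h5 : 5 ≤ #A := by
      have h0 : 0 < #A := card_pos.2 ⟨_, he⟩
      obtain ⟨k, hk⟩ := even_card hG
      omega
    by_cases hA : CyclicallyFourConnected tail σ A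
    · exact quellable_of_cyclicallyFourConnected IH hG hA h5 hH hE he heH
    · obtain ⟨T, hT, hT2, hT2', h3⟩ := exists_three_cut hG h5 hA
      exact quellable_of_three_cut IH hG hH hT h3 (fun S hS ↦ hE.exists_notMem hG hH hS) hT2 hT2' he
  · simp only [HasNoEnds, not_forall] at hE
    obtain ⟨d, hdH, hd, hend⟩ := hE
    exact (step d hdH hd).of_sdiff_end hG hH hd fun d' h1 h2 ↦
      by_contra fun h ↦ hend ⟨d', h1, h2, h⟩

/-- The main theorem for cubic multigraphs presented by darts. -/
theorem quellable (hG : IsBridgelessCubic tail σ A) (hH : IsCofactor tail σ A H)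
    (he : tail e ∈ A) : Quellable tail σ A H e := by
  induction hn : #A using Nat.strong_induction_on generalizing σ A H e with
  | _ n ih =>
  exact quellable_of_quellableBelow
    (fun σ B H e hB hG hH he ↦ ih _ (hn ▸ hB) hG hH he rfl) hG hH he

end DartGraph

namespace SimpleGraph

open Finset

variable {V : Type*} [DecidableEq V] {G : SimpleGraph V} [Fintype G.Dart]

theorem card_dart_fst_eq (v : V) : #{d : G.Dart | d.fst = v} = (G.neighborSet v).ncard := by
  rw [← Set.ncard_coe_finset, ← Set.InjOn.ncard_image (f := fun d : G.Dart ↦ d.snd)]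
  · congr 1
    ext w
    simp only [coe_filter, mem_univ, true_and, Set.mem_image, Set.mem_ofPred_eq, mem_neighborSet]
    exact ⟨fun ⟨d, hd, hw⟩ ↦ hd ▸ hw ▸ d.adj, fun h ↦ ⟨⟨(v, w), h⟩, rfl, rfl⟩⟩
  · intro d hd d' hd' h
    simp only [coe_filter, mem_univ, true_and, Set.mem_ofPred_eq] at hd hd'
    exact Dart.ext _ _ (Prod.ext (hd.trans hd'.symm) h)

open DartGraph in
theorem isBridgelessCubic_darts [Fintype V] (hcubic : ∀ v : V, (G.neighborSet v).ncard = 3)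
    (hbridgeless : ∀ e ∈ G.edgeSet, ¬ G.IsBridge e) :
    IsBridgelessCubic (fun d : G.Dart ↦ d.fst) Dart.symm univ := by
  refine ⟨fun v ↦ (card_dart_fst_eq v).trans (hcubic v), fun d _ ↦ d.symm_symm,
    fun d _ ↦ d.symm_ne, fun _ _ ↦ mem_univ _, fun S _ hS ↦ ?_⟩
  obtain ⟨d, hd⟩ := card_eq_one.1 hS
  have hdS : d ∈ cut (fun d : G.Dart ↦ d.fst) Dart.symm S := by simp [hd]
  rw [mem_cut] at hdS
  obtain ⟨p⟩ := not_not.1 (mt isBridge_iff.2 (hbridgeless s(d.fst, d.snd) d.adj))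
  obtain ⟨d', -, h1, h2⟩ := p.exists_boundary_dart S hdS.1 hdS.2
  have hadj := d'.adj
  rw [deleteEdges_adj] at hadj
  have hm : (⟨d'.toProd, hadj.1⟩ : G.Dart) ∈ cut (fun d : G.Dart ↦ d.fst) Dart.symm S :=
    mem_cut.2 ⟨h1, h2⟩
  rw [hd, mem_singleton] at hm
  exact hadj.2 (congrArg Dart.edge hm)

/-- The subgraph whose edges are given by a symmetric set of darts. -/
def subgraphOfDarts (M : Set G.Dart) (hM : ∀ d, d ∈ M → d.symm ∈ M) : G.Subgraph where
  verts := Set.univ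
  Adj v w := ∃ h : G.Adj v w, ⟨(v, w), h⟩ ∈ M
  adj_sub h := h.1
  edge_vert _ := Set.mem_univ _
  symm := ⟨fun _ _ h ↦ ⟨h.1.symm, hM _ h.2⟩⟩

end SimpleGraph

/-- **Main theorem.** For every bridgeless cubic graph `G`, every `1⁺`-factor `F` of `G`
(a spanning subgraph with all degrees at least 1) and every edge `e` of `G`, there is a
perfect matching `M` of `G` containing `e` such that deleting the edges of `F` and `M`
leaves a bipartite graph. -/
theorem quelling_pair_through_edge {V : Type*} [Fintype V] (G : SimpleGraph V)
    (hcubic : ∀ v : V, (G.neighborSet v).ncard = 3)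
    (hbridgeless : ∀ e : Sym2 V, ¬ G.IsBridge e)
    (F : G.Subgraph) (hFspan : F.IsSpanning)
    (hFdeg : ∀ v : V, (F.neighborSet v).Nonempty)
    (e : Sym2 V) (he : e ∈ G.edgeSet) :
    ∃ M : G.Subgraph, M.IsPerfectMatching ∧ e ∈ M.edgeSet ∧
      (G.deleteEdges (F.edgeSet ∪ M.edgeSet)).Colorable 2 := by
  classical
  have hG := SimpleGraph.isBridgelessCubic_darts hcubic fun e _ ↦ hbridgeless e
  have hH : DartGraph.IsCofactor (fun d : G.Dart ↦ d.fst) SimpleGraph.Dart.symm Finset.univ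
      {d | d.edge ∉ F.edgeSet} := by
    refine ⟨fun d _ ↦ by simp, fun v _ ↦ ?_⟩
    obtain ⟨w, hw⟩ := hFdeg v
    exact ⟨⟨(v, w), hw.adj_sub⟩, rfl, not_not.2 hw⟩
  induction e with | _ u v =>
  obtain ⟨M, c, hM, heM, hc⟩ := DartGraph.quellable (e := ⟨(u, v), he⟩) hG hH (Finset.mem_univ _)
  refine ⟨SimpleGraph.subgraphOfDarts M fun d ↦ (hM.symm d (Finset.mem_univ _)).1, ?_,
    ⟨he, heM⟩, ?_⟩
  · rw [SimpleGraph.Subgraph.isPerfectMatching_iff]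
    intro x
    obtain ⟨d, ⟨rfl, hdM⟩, hu⟩ := hM.unique x (Finset.mem_univ _)
    exact ⟨d.snd, ⟨d.adj, hdM⟩, fun w hw ↦
      congrArg (fun d ↦ d.snd) (hu ⟨(d.fst, w), hw.1⟩ ⟨rfl, hw.2⟩)⟩
  · let φ : (G.deleteEdges (F.edgeSet ∪ (SimpleGraph.subgraphOfDarts M
        fun d ↦ (hM.symm d (Finset.mem_univ _)).1).edgeSet)).Coloring Bool :=
      SimpleGraph.Coloring.mk c fun {x y} h ↦ by
        rw [SimpleGraph.deleteEdges_adj, Set.mem_union, not_or] at h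
        exact hc ⟨(x, y), h.1⟩ (Finset.mem_univ _) ⟨h.2.1, fun hm ↦ h.2.2 ⟨h.1, hm⟩⟩
    exact φ.colorable
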